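/- arXiv:math/0309022 — 3 statements merged into one kernel-verified Lean document; each statement's English description precedes it below -/
import Mathlib

section
/- Let ζ ∈ ∂𝔻 and let z₀ ∈ I(ζ) be strongly minimal in ζ. Then z₀ cannot have priority over any other point in either wing: if z₀ ∈ I⁺(ζ) and w ∈ I⁺(ζ) with w ≠ z₀, then there exists a curve converging to ζ from the left whose accumulation set contains w but not z₀ (so z₀ does not have priority over w in I⁺(ζ)); the analogous statement holds for I⁻(ζ) with curves converging from the right. -/
open Filter Topology Metric Set OnePoint

noncomputable section

local notation "ℂ∞" => OnePoint ℂ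

/-- A set `K` is locally connected (connected im kleinen) at a point `z`:
every neighborhood of `z` in `K` contains a connected neighborhood of `z` in `K`. -/
def LocallyConnectedAt {X : Type*} [TopologicalSpace X] (K : Set X) (z : X) : Prop :=
  ∀ V ∈ 𝓝[K] z, ∃ N ∈ 𝓝[K] z, N ⊆ K ∩ V ∧ IsConnected N

/-- `φ : ℂ → ℂ∞` is holomorphic, as a map into the Riemann sphere, on `D`:
near every point of `D` it is either given by an analytic `ℂ`-valued function, or by the
reciprocal of one. -/
def HolomorphicIntoSphereOn (φ : ℂ → ℂ∞) (D : Set ℂ) : Prop :=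
  ∀ z ∈ D,
    (∃ g : ℂ → ℂ, AnalyticAt ℂ g z ∧ ∀ᶠ w in 𝓝 z, φ w = ((g w : ℂ) : ℂ∞)) ∨
    (∃ g : ℂ → ℂ, AnalyticAt ℂ g z ∧
      ∀ᶠ w in 𝓝 z, φ w = if g w = 0 then (∞ : ℂ∞) else (((g w)⁻¹ : ℂ) : ℂ∞))

/-- The impression of the prime end `ζ ∈ ∂𝔻` (cluster set of `φ` at `ζ`). -/
def impression (φ : ℂ → ℂ∞) (ζ : ℂ) : Set ℂ∞ :=
  {z | ∃ w : ℕ → ℂ, (∀ j, w j ∈ ball (0 : ℂ) 1) ∧ Tendsto w atTop (𝓝 ζ) ∧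
    Tendsto (fun j => φ (w j)) atTop (𝓝 z)}

/-- The set of principal points of the prime end `ζ` (radial cluster set of `φ` at `ζ`). -/
def principalPoints (φ : ℂ → ℂ∞) (ζ : ℂ) : Set ℂ∞ :=
  {z | ∃ t : ℕ → ℝ, (∀ j, t j ∈ Ico (0 : ℝ) 1) ∧ Tendsto t atTop (𝓝 1) ∧
    Tendsto (fun j => φ ((t j : ℂ) * ζ)) atTop (𝓝 z)}

/-- The accumulation set of a curve `Γ : [0,∞) → ℂ∞`: all limits of sequences `Γ (t j)`
with `t j → ∞`. -/
def accSet (Γ : ℝ → ℂ∞) : Set ℂ∞ :=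
  {z | ∃ t : ℕ → ℝ, Tendsto t atTop atTop ∧ Tendsto (fun j => Γ (t j)) atTop (𝓝 z)}

/-- `Γ` is a (continuous) curve `[0,∞) → U`. -/
def IsCurveIn (U : Set ℂ∞) (Γ : ℝ → ℂ∞) : Prop :=
  ContinuousOn Γ (Ici 0) ∧ MapsTo Γ (Ici 0) U

/-- The curve `Γ : [0,∞) → U` converges to the prime end `ζ`: `φ⁻¹(Γ(t)) = ψ(Γ(t)) → ζ`. -/
def ConvergesToPrimeEnd (U : Set ℂ∞) (ψ : ℂ∞ → ℂ) (Γ : ℝ → ℂ∞) (ζ : ℂ) : Prop :=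
  IsCurveIn U Γ ∧ Tendsto (fun t => ψ (Γ t)) atTop (𝓝 ζ)

/-- `Γ` converges to the prime end `ζ` from the left. -/
def ConvergesFromLeft (U : Set ℂ∞) (ψ : ℂ∞ → ℂ) (Γ : ℝ → ℂ∞) (ζ : ℂ) : Prop :=
  ConvergesToPrimeEnd U ψ Γ ζ ∧ ∀ᶠ t in atTop, 0 ≤ (ψ (Γ t) / ζ).im

/-- `Γ` converges to the prime end `ζ` from the right. -/
def ConvergesFromRight (U : Set ℂ∞) (ψ : ℂ∞ → ℂ) (Γ : ℝ → ℂ∞) (ζ : ℂ) : Prop :=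
  ConvergesToPrimeEnd U ψ Γ ζ ∧ ∀ᶠ t in atTop, (ψ (Γ t) / ζ).im ≤ 0

/-- The left wing `I⁺(ζ)` of the prime end `ζ`. -/
def leftWing (U : Set ℂ∞) (ψ : ℂ∞ → ℂ) (ζ : ℂ) : Set ℂ∞ :=
  {z | ∃ Γ : ℝ → ℂ∞, ConvergesFromLeft U ψ Γ ζ ∧ z ∈ accSet Γ}

/-- The right wing `I⁻(ζ)` of the prime end `ζ`. -/
def rightWing (U : Set ℂ∞) (ψ : ℂ∞ → ℂ) (ζ : ℂ) : Set ℂ∞ :=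
  {z | ∃ Γ : ℝ → ℂ∞, ConvergesFromRight U ψ Γ ζ ∧ z ∈ accSet Γ}

/-- `z` has priority over `w` in the left wing of `ζ`. -/
def PriorityLeft (U : Set ℂ∞) (ψ : ℂ∞ → ℂ) (ζ : ℂ) (z w : ℂ∞) : Prop :=
  ∀ Γ : ℝ → ℂ∞, ConvergesFromLeft U ψ Γ ζ → w ∈ accSet Γ → z ∈ accSet Γ

/-- `z` has priority over `w` in the right wing of `ζ`. -/
def PriorityRight (U : Set ℂ∞) (ψ : ℂ∞ → ℂ) (ζ : ℂ) (z w : ℂ∞) : Prop :=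
  ∀ Γ : ℝ → ℂ∞, ConvergesFromRight U ψ Γ ζ → w ∈ accSet Γ → z ∈ accSet Γ

/-- The sequence `w` accumulates at `z` (some subsequence converges to `z`). -/
def SeqAccumAt (w : ℕ → ℂ∞) (z : ℂ∞) : Prop :=
  ∃ n : ℕ → ℕ, StrictMono n ∧ Tendsto (fun j => w (n j)) atTop (𝓝 z)

/-- `z₀` is strongly minimal in the prime end `ζ`: every sequence in `U` converging to the
prime end `ζ` and not accumulating at `z₀` lies on a curve converging to `ζ` whose
accumulation set misses `z₀`. -/
def StronglyMinimal (U : Set ℂ∞) (ψ : ℂ∞ → ℂ) (ζ : ℂ) (z₀ : ℂ∞) : Prop :=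
  ∀ w : ℕ → ℂ∞, (∀ j, w j ∈ U) → Tendsto (fun j => ψ (w j)) atTop (𝓝 ζ) →
    ¬ SeqAccumAt w z₀ →
    ∃ Γ : ℝ → ℂ∞, ConvergesToPrimeEnd U ψ Γ ζ ∧ (∀ j, ∃ t, 0 ≤ t ∧ Γ t = w j) ∧
      z₀ ∉ accSet Γ




open MeasureTheory in
lemma aux_slice (h : ℝ × ℝ → ENNReal) (hm : Measurable h) (a : ℝ) (J : Set ℝ) (E : ENNReal)
    (hE : ∫⁻ p in Ioo a (a+1) ×ˢ J, h p ≤ E) :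
    ∃ x ∈ Ioo a (a+1), ∫⁻ y in J, h (x, y) ≤ E := by
  have h1 : ∫⁻ p in Ioo a (a+1) ×ˢ J, h p = ∫⁻ x in Ioo a (a+1), ∫⁻ y in J, h (x,y) := by
    rw [Measure.volume_eq_prod, setLIntegral_prod]
    exact hm.aemeasurable
  rw [h1] at hE
  obtain ⟨x, hx, hx'⟩ := exists_le_setLAverage (μ := volume) (s := Ioo a (a+1))
    (f := fun x => ∫⁻ y in J, h (x,y)) (by simp) (by simp)
    (hm.lintegral_prod_right').aemeasurable
  refine ⟨x, hx, hx'.trans ?_⟩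
  rw [setLAverage_eq]
  simpa using hE

open MeasureTheory in
lemma aux_osc (p q : ℝ → ℂ) (b b' η : ℝ) (hb : b' - b ≤ 4) (hη : 0 < η)
    (hd : ∀ y ∈ Ioo b b', HasDerivAt p (q y) y) (hq : ContinuousOn q (Ioo b b'))
    (hE : ∫⁻ y in Ioo b b', ENNReal.ofReal (‖q y‖ ^ 2) ≤ ENNReal.ofReal (η ^ 2)) :
    ∀ y₁ ∈ Ioo b b', ∀ y₂ ∈ Ioo b b', ‖p y₁ - p y₂‖ ≤ 3 * η := by
  have key : ∀ y₁ ∈ Ioo b b', ∀ y₂ ∈ Ioo b b', y₁ ≤ y₂ → ‖p y₂ - p y₁‖ ≤ 3 * η := by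
    intro y₁ h1 y₂ h2 h12
    have hsub : Icc y₁ y₂ ⊆ Ioo b b' := fun y hy => ⟨h1.1.trans_le hy.1, hy.2.trans_lt h2.2⟩
    have hqc : ContinuousOn q (uIcc y₁ y₂) := by rw [uIcc_of_le h12]; exact hq.mono hsub
    have hi : ∫ y in y₁..y₂, q y = p y₂ - p y₁ := by
      apply intervalIntegral.integral_eq_sub_of_hasDerivAt
      · intro y hy; rw [uIcc_of_le h12] at hy; exact hd y (hsub hy)
      · exact hqc.intervalIntegrable
    have hsq : ∫ y in y₁..y₂, ‖q y‖ ^ 2 ≤ η ^ 2 := by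
      rw [intervalIntegral.integral_of_le h12]
      have hint : IntegrableOn (fun y => ‖q y‖ ^ 2) (Ioc y₁ y₂) := by
        have : IntervalIntegrable (fun y => ‖q y‖ ^ 2) volume y₁ y₂ := (hqc.norm.pow 2).intervalIntegrable
        exact (intervalIntegrable_iff_integrableOn_Ioc_of_le h12).1 this
      have h3 := ofReal_integral_eq_lintegral_ofReal hint (ae_of_all _ fun y => by positivity)
      have h4 : ∫⁻ y in Ioc y₁ y₂, ENNReal.ofReal (‖q y‖ ^ 2) ≤ ENNReal.ofReal (η ^ 2) :=
        (lintegral_mono_set (Ioc_subset_Icc_self.trans hsub)).trans hE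
      rw [← h3] at h4
      exact (ENNReal.ofReal_le_ofReal_iff (by positivity)).1 h4
    rw [← hi]
    calc ‖∫ y in y₁..y₂, q y‖ ≤ ∫ y in y₁..y₂, ‖q y‖ :=
          intervalIntegral.norm_integral_le_integral_norm h12
      _ ≤ ∫ y in y₁..y₂, (η / 2 + (2 * η)⁻¹ * ‖q y‖ ^ 2) := by
          apply intervalIntegral.integral_mono_on h12
          · exact hqc.norm.intervalIntegrable
          · exact (continuousOn_const.add (continuousOn_const.mul (hqc.norm.pow 2))).intervalIntegrable
          · intro y hy
            have : η / 2 + (2 * η)⁻¹ * ‖q y‖ ^ 2 - ‖q y‖ = (2 * η)⁻¹ * (η - ‖q y‖) ^ 2 := by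
              field_simp; ring
            have h0 : 0 ≤ (2 * η)⁻¹ * (η - ‖q y‖) ^ 2 := by positivity
            linarith
      _ = (y₂ - y₁) * (η / 2) + (2 * η)⁻¹ * ∫ y in y₁..y₂, ‖q y‖ ^ 2 := by
          rw [intervalIntegral.integral_add]
          · simp; ring
          · simp
          · exact (continuousOn_const.mul (hqc.norm.pow 2)).intervalIntegrable
      _ ≤ 4 * (η / 2) + (2 * η)⁻¹ * η ^ 2 := by
          gcongr
          linarith [h1.1, h2.2]
      _ ≤ 3 * η := by
          have : (2 * η)⁻¹ * η ^ 2 = η / 2 := by field_simp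
          rw [this]; linarith
  intro y₁ h1 y₂ h2
  rcases le_total y₁ y₂ with h | h
  · rw [norm_sub_rev]; exact key _ h1 _ h2 h
  · exact key _ h2 _ h1 h

lemma aux_det (c : ℂ) : ((ContinuousLinearMap.toSpanSingleton ℂ c).restrictScalars ℝ).det = ‖c‖ ^ 2 := by
  rw [← Complex.normSq_eq_norm_sq, ← Algebra.norm_complex_apply, Algebra.norm_apply]
  rw [ContinuousLinearMap.det]
  congr 1
  ext <;> simp [mul_comm]

/-- half strip -/
def auxStrip (s : ℝ) : Set ℂ := Ioi s ×ℂ Ioo (-(Real.pi / 2)) (Real.pi / 2)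

lemma auxStrip_open (s : ℝ) : IsOpen (auxStrip s) := isOpen_Ioi.reProdIm isOpen_Ioo

open MeasureTheory in
lemma aux_tail (f : ℂ → ℂ) (s₀ R : ℝ) (hd : DifferentiableOn ℂ f (auxStrip s₀))
    (hi : InjOn f (auxStrip s₀)) (hR : ∀ w ∈ auxStrip s₀, ‖f w‖ ≤ R) (η : ℝ) (hη : 0 < η) :
    ∃ S, s₀ ≤ S ∧ ∀ s ≥ S, ∫⁻ w in auxStrip s, ENNReal.ofReal (‖deriv f w‖ ^ 2) ≤ ENNReal.ofReal (η ^ 2) := by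
  have hmeas : ∀ s, MeasurableSet (auxStrip s) := fun s => (auxStrip_open s).measurableSet
  have htot : ∫⁻ w in auxStrip s₀, ENNReal.ofReal (‖deriv f w‖ ^ 2) ≠ ⊤ := by
    have h1 := lintegral_abs_det_fderiv_eq_addHaar_image volume (f := f)
      (f' := fun w => (ContinuousLinearMap.toSpanSingleton ℂ (deriv f w)).restrictScalars ℝ) (hmeas s₀) (by
        intro w hw
        have : HasDerivAt f (deriv f w) w :=
          (hd.differentiableAt ((auxStrip_open s₀).mem_nhds hw)).hasDerivAt
        exact (this.hasFDerivAt.restrictScalars ℝ).hasFDerivWithinAt) hi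
    simp only [aux_det, abs_pow, abs_norm] at h1
    rw [h1]
    have : f '' auxStrip s₀ ⊆ closedBall 0 R := by
      rintro _ ⟨w, hw, rfl⟩; simpa using hR w hw
    exact ((measure_mono this).trans_lt measure_closedBall_lt_top).ne
  set ν := (volume.restrict (auxStrip s₀)).withDensity (fun w => ENNReal.ofReal (‖deriv f w‖ ^ 2)) with hν
  have hνfin : ν univ ≠ ⊤ := by rw [hν, withDensity_apply _ MeasurableSet.univ]; simpa using htot
  have hνs : ∀ s, s₀ ≤ s → ν (auxStrip s) = ∫⁻ w in auxStrip s, ENNReal.ofReal (‖deriv f w‖ ^ 2) := by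
    intro s hs
    rw [hν, withDensity_apply _ (hmeas s), Measure.restrict_restrict (hmeas s)]
    congr 2
    apply inter_eq_left.2
    intro w hw
    exact ⟨lt_of_le_of_lt hs hw.1, hw.2⟩
  have hlim : Tendsto (fun n : ℕ => ν (auxStrip n)) atTop (𝓝 0) := by
    have h2 := tendsto_measure_iInter_atTop (μ := ν) (s := fun n : ℕ => auxStrip n)
      (fun n => (hmeas n).nullMeasurableSet)
      (fun m n hmn w hw => ⟨lt_of_le_of_lt (Nat.cast_le (α := ℝ).2 hmn) (mem_Ioi.1 hw.1), hw.2⟩)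
      ⟨0, fun h => hνfin (top_le_iff.1 (h ▸ measure_mono (subset_univ _)))⟩
    have h3 : ⋂ n : ℕ, auxStrip n = ∅ := by
      ext w
      simp only [mem_iInter, mem_empty_iff_false, iff_false, not_forall]
      obtain ⟨n, hn⟩ := exists_nat_gt w.re
      exact ⟨n, fun h => lt_asymm hn h.1⟩
    rwa [h3, measure_empty] at h2
  obtain ⟨n, hn⟩ := ((hlim.eventually (Iio_mem_nhds (show (0:ENNReal) < ENNReal.ofReal (η^2) from ENNReal.ofReal_pos.2 (by positivity)))).and
    (eventually_ge_atTop (⌈s₀⌉₊))).exists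
  have hn2 : s₀ ≤ n := Nat.ceil_le.1 hn.2
  refine ⟨n, hn2, fun s hs => ?_⟩
  rw [← hνs s (hn2.trans hs)]
  refine (measure_mono ?_).trans hn.1.le
  intro w hw
  exact ⟨lt_of_le_of_lt hs hw.1, hw.2⟩

open MeasureTheory in
lemma aux_rect (g : ℂ → ENNReal) (hg : Measurable g) (A B : Set ℝ) (hA : MeasurableSet A) (hB : MeasurableSet B) (T : Set ℂ)
    (h : A ×ℂ B ⊆ T) : ∫⁻ p in A ×ˢ B, g (p.1 + p.2 * Complex.I) ≤ ∫⁻ w in T, g w := by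
  have h1 := (Complex.volume_preserving_equiv_real_prod.symm).setLIntegral_comp_preimage_emb
    (Complex.measurableEquivRealProd.symm.measurableEmbedding) g T
  rw [← h1]
  have h2 : ∀ p : ℝ × ℝ, Complex.measurableEquivRealProd.symm p = p.1 + p.2 * Complex.I := by
    intro p; apply Complex.ext <;> simp
  simp only [h2]
  apply lintegral_mono_set
  intro p hp
  show Complex.measurableEquivRealProd.symm p ∈ T
  rw [h2]
  exact h (by simpa [Complex.mem_reProdIm] using hp)

open MeasureTheory in
lemma aux_rect' (g : ℂ → ENNReal) (hg : Measurable g) (A B : Set ℝ) (hA : MeasurableSet A) (hB : MeasurableSet B) (T : Set ℂ)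
    (h : A ×ℂ B ⊆ T) : ∫⁻ p in B ×ˢ A, g (p.2 + p.1 * Complex.I) ≤ ∫⁻ w in T, g w := by
  refine le_trans (le_of_eq ?_) (aux_rect g hg A B hA hB T h)
  have h1 := (Measure.measurePreserving_swap (μ := (volume : Measure ℝ)) (ν := (volume : Measure ℝ))).setLIntegral_comp_preimage_emb
    (MeasurableEquiv.prodComm.measurableEmbedding) (fun p : ℝ × ℝ => g (p.1 + p.2 * Complex.I)) (A ×ˢ B)
  rw [Measure.volume_eq_prod, ← h1, Set.preimage_swap_prod]
  rfl

lemma aux_cross (f : ℂ → ℂ) (s₀ R : ℝ) (hd : DifferentiableOn ℂ f (auxStrip s₀))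
    (hi : InjOn f (auxStrip s₀)) (hR : ∀ w ∈ auxStrip s₀, ‖f w‖ ≤ R) (ε : ℝ) (hε : 0 < ε) :
    ∃ S : ℝ, ∀ s : ℝ, S ≤ s → ∃ x ∈ Ioo (s - 1) s, ∀ y ∈ Ioo (-(Real.pi / 2)) (Real.pi / 2),
      ‖f (x + y * Complex.I) - f s‖ ≤ ε := by
  obtain ⟨η, hη, hηε⟩ : ∃ η : ℝ, 0 < η ∧ 12 * η ≤ ε := ⟨ε / 12, by positivity, by linarith⟩
  obtain ⟨S, hS0, hS⟩ := aux_tail f s₀ R hd hi hR η hη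
  refine ⟨S + 1, fun s hs => ?_⟩
  have hE := hS (s - 1) (by linarith)
  have hpi := Real.pi_gt_three
  have hpi4 := Real.pi_le_four
  set g : ℂ → ENNReal := fun w => ENNReal.ofReal (‖deriv f w‖ ^ 2) with hg
  have hgm : Measurable g := by
    have := measurable_deriv f
    fun_prop
  have hsub0 : auxStrip (s - 1) ⊆ auxStrip s₀ := fun w hw =>
    ⟨lt_of_le_of_lt (show s₀ ≤ s - 1 by linarith) (mem_Ioi.1 hw.1), hw.2⟩
  have hder : ∀ w ∈ auxStrip (s - 1), HasDerivAt f (deriv f w) w := fun w hw =>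
    (hd.differentiableAt ((auxStrip_open s₀).mem_nhds (hsub0 hw))).hasDerivAt
  have hdc : ContinuousOn (deriv f) (auxStrip (s - 1)) :=
    ((hd.deriv (auxStrip_open s₀)).continuousOn).mono hsub0
  have hmem : ∀ x y : ℝ, s - 1 < x → y ∈ Ioo (-(Real.pi / 2)) (Real.pi / 2) →
      (x + y * Complex.I : ℂ) ∈ auxStrip (s - 1) := by
    intro x y hx hy
    refine ⟨?_, ?_⟩ <;> simp [hx, hy.1, hy.2]
  -- vertical slices
  have hV : ∀ a, s - 1 ≤ a → ∃ x ∈ Ioo a (a + 1), ∀ y₁ ∈ Ioo (-(Real.pi / 2)) (Real.pi / 2),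
      ∀ y₂ ∈ Ioo (-(Real.pi / 2)) (Real.pi / 2), ‖f (x + y₁ * Complex.I) - f (x + y₂ * Complex.I)‖ ≤ 3 * η := by
    intro a ha
    have h1 := (aux_rect g hgm (Ioo a (a+1)) (Ioo (-(Real.pi / 2)) (Real.pi / 2)) measurableSet_Ioo
      measurableSet_Ioo (auxStrip (s - 1)) (fun w hw => ⟨lt_of_le_of_lt ha hw.1.1, hw.2⟩)).trans hE
    obtain ⟨x, hx, hx'⟩ := aux_slice (fun p : ℝ × ℝ => g (p.1 + p.2 * Complex.I)) (by fun_prop) a _ _ h1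
    refine ⟨x, hx, ?_⟩
    refine aux_osc (fun y => f (x + y * Complex.I)) (fun y => deriv f (x + y * Complex.I) * Complex.I)
      (-(Real.pi / 2)) (Real.pi / 2) η (by linarith) hη ?_ ?_ ?_
    · intro y hy
      have h2 := hder _ (hmem x y (by linarith [hx.1]) hy)
      have h3 : HasDerivAt (fun y : ℝ => (x + y * Complex.I : ℂ)) Complex.I y := by
        simpa using ((Complex.ofRealCLM.hasDerivAt (x := y)).mul_const Complex.I).const_add (x : ℂ)
      exact h2.comp y h3
    · refine ContinuousOn.mul (hdc.comp (by fun_prop) ?_) continuousOn_const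
      intro y hy
      exact hmem x y (by linarith [hx.1]) hy
    · simpa [hg] using hx'
  have hH : ∀ b, -(Real.pi / 2) ≤ b → b + 1 ≤ Real.pi / 2 → ∃ y ∈ Ioo b (b + 1), ∀ x₁ ∈ Ioo (s - 1) (s + 1),
      ∀ x₂ ∈ Ioo (s - 1) (s + 1), ‖f (x₁ + y * Complex.I) - f (x₂ + y * Complex.I)‖ ≤ 3 * η := by
    intro b hb hb'
    have h1 := (aux_rect' g hgm (Ioo (s - 1) (s+1)) (Ioo b (b + 1)) measurableSet_Ioo
      measurableSet_Ioo (auxStrip (s - 1)) (fun w hw => ⟨hw.1.1, lt_of_le_of_lt hb hw.2.1, lt_of_lt_of_le hw.2.2 hb'⟩)).trans hE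
    obtain ⟨y, hy, hy'⟩ := aux_slice (fun p : ℝ × ℝ => g (p.2 + p.1 * Complex.I)) (by fun_prop) b _ _ h1
    have hyy : y ∈ Ioo (-(Real.pi / 2)) (Real.pi / 2) := ⟨by linarith [hy.1], by linarith [hy.2]⟩
    refine ⟨y, hy, ?_⟩
    refine aux_osc (fun x => f (x + y * Complex.I)) (fun x => deriv f (x + y * Complex.I))
      (s - 1) (s + 1) η (by linarith) hη ?_ ?_ ?_
    · intro x hx
      have h2 := hder _ (hmem x y hx.1 hyy)
      have h3 : HasDerivAt (fun x : ℝ => (x + y * Complex.I : ℂ)) 1 x := by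
        simpa using (Complex.ofRealCLM.hasDerivAt (x := x)).add_const (y * Complex.I : ℂ)
      have h4 := h2.comp x h3
      rw [mul_one] at h4
      exact h4
    · refine (hdc.comp (by fun_prop) ?_)
      intro x hx
      exact hmem x y hx.1 hyy
    · simpa [hg] using hy'
  obtain ⟨x₁, hx₁, hV1⟩ := hV (s - 1) le_rfl
  obtain ⟨x₂, hx₂, hV2⟩ := hV s (by linarith)
  obtain ⟨y₁, hy₁, hH1⟩ := hH (-3/2) (by linarith) (by linarith)
  obtain ⟨y₂, hy₂, hH2⟩ := hH (1/2) (by linarith) (by linarith)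
  have hx₁' : x₁ < s := by linarith [hx₁.2]
  have hyy₁ : y₁ ∈ Ioo (-(Real.pi / 2)) (Real.pi / 2) := ⟨by linarith [hy₁.1], by linarith [hy₁.2]⟩
  have hyy₂ : y₂ ∈ Ioo (-(Real.pi / 2)) (Real.pi / 2) := ⟨by linarith [hy₂.1], by linarith [hy₂.2]⟩
  have hxx₁ : x₁ ∈ Ioo (s - 1) (s + 1) := ⟨hx₁.1, by linarith⟩
  have hxx₂ : x₂ ∈ Ioo (s - 1) (s + 1) := ⟨by linarith [hx₂.1], hx₂.2⟩
  refine ⟨x₁, ⟨hx₁.1, hx₁'⟩, fun y hy => ?_⟩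
  set c := f (x₁ + y₁ * Complex.I) with hc
  have hmax : ‖f s - c‖ ≤ 9 * η := by
    have hlt1 : x₁ < x₂ := by linarith [hx₂.1]
    have hlt2 : y₁ < y₂ := by linarith [hy₁.2, hy₂.1]
    have hcl : closure (Ioo x₁ x₂ ×ℂ Ioo y₁ y₂) = Icc x₁ x₂ ×ℂ Icc y₁ y₂ := by
      rw [Complex.closure_reProdIm, closure_Ioo hlt1.ne, closure_Ioo hlt2.ne]
    refine Complex.norm_le_of_forall_mem_frontier_norm_le (f := fun w => f w - c)
      (U := Ioo x₁ x₂ ×ℂ Ioo y₁ y₂) ((isBounded_Ioo _ _).reProdIm (isBounded_Ioo _ _)) ?_ ?_ ?_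
    · apply DifferentiableOn.diffContOnCl
      refine DifferentiableOn.sub_const ?_ c
      refine hd.mono ?_
      rw [hcl]
      intro w hw
      refine hsub0 ⟨lt_of_lt_of_le hx₁.1 hw.1.1, lt_of_lt_of_le hyy₁.1 hw.2.1, lt_of_le_of_lt hw.2.2 hyy₂.2⟩
    · intro w hw
      have hw' : w ∈ closure (Ioo x₁ x₂ ×ℂ Ioo y₁ y₂) := frontier_subset_closure hw
      rw [hcl] at hw'
      obtain ⟨⟨ha1, ha2⟩, hb1, hb2⟩ := hw'
      have hre : w.re ∈ Ioo (s - 1) (s + 1) := ⟨lt_of_lt_of_le hxx₁.1 ha1, lt_of_le_of_lt ha2 hxx₂.2⟩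
      have him : w.im ∈ Ioo (-(Real.pi / 2)) (Real.pi / 2) := ⟨lt_of_lt_of_le hyy₁.1 hb1, lt_of_le_of_lt hb2 hyy₂.2⟩
      rw [Complex.frontier_reProdIm, closure_Ioo hlt1.ne, closure_Ioo hlt2.ne, frontier_Ioo hlt1, frontier_Ioo hlt2] at hw
      have hwe : f w = f (w.re + w.im * Complex.I) := by rw [Complex.re_add_im]
      show ‖f w - c‖ ≤ 9 * η
      rw [hwe]
      rcases hw with ⟨_, hw⟩ | ⟨hw, _⟩
      · rcases hw with hw | hw
        · rw [show w.im = y₁ from hw]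
          linarith [hH1 _ hre _ hxx₁]
        · rw [show w.im = y₂ from hw]
          have t := norm_sub_le_norm_sub_add_norm_sub (f (w.re + y₂ * Complex.I)) (f (x₁ + y₂ * Complex.I)) c
          linarith [hH2 _ hre _ hxx₁, hV1 _ hyy₂ _ hyy₁]
      · rcases hw with hw | hw
        · rw [show w.re = x₁ from hw]
          linarith [hV1 _ him _ hyy₁]
        · rw [show w.re = x₂ from hw]
          have t := norm_sub_le_norm_sub_add_norm_sub (f (x₂ + w.im * Complex.I)) (f (x₂ + y₁ * Complex.I)) c
          linarith [hV2 _ him _ hyy₁, hH1 _ hxx₂ _ hxx₁]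
    · rw [hcl]
      refine ⟨⟨?_, ?_⟩, ?_, ?_⟩ <;> simp <;> linarith [hx₂.1, hy₁.2, hy₂.1]
  have t := norm_sub_le_norm_sub_add_norm_sub (f (x₁ + y * Complex.I)) c (f s)
  rw [norm_sub_rev c] at t
  linarith [hV1 _ hy _ hyy₁]

/-- strip to disk map -/
def auxM (w : ℂ) : ℂ := (Complex.exp w - 1) / (Complex.exp w + 1)

lemma auxE_re (w : ℂ) (hw : w.im ∈ Ioo (-(Real.pi / 2)) (Real.pi / 2)) : 0 < (Complex.exp w).re := by
  rw [Complex.exp_re]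
  exact mul_pos (Real.exp_pos _) (Real.cos_pos_of_mem_Ioo hw)

lemma auxE_ne (w : ℂ) (hw : w.im ∈ Ioo (-(Real.pi / 2)) (Real.pi / 2)) : Complex.exp w + 1 ≠ 0 := by
  intro h
  have := congrArg Complex.re h
  have h2 := auxE_re w hw
  simp only [Complex.add_re, Complex.one_re, Complex.zero_re] at this
  linarith

lemma auxM_mem (w : ℂ) (hw : w.im ∈ Ioo (-(Real.pi / 2)) (Real.pi / 2)) : ‖auxM w‖ < 1 := by
  have h2 := auxE_re w hw
  rw [auxM, norm_div, div_lt_one (norm_pos_iff.2 (auxE_ne w hw))]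
  rw [← sq_lt_sq₀ (norm_nonneg _) (norm_nonneg _), ← Complex.normSq_eq_norm_sq, ← Complex.normSq_eq_norm_sq,
    Complex.normSq_apply, Complex.normSq_apply]
  simp only [Complex.add_re, Complex.one_re, Complex.sub_re, Complex.add_im, Complex.sub_im, Complex.one_im]
  nlinarith

lemma auxM_inj (w w' : ℂ) (hw : w.im ∈ Ioo (-(Real.pi / 2)) (Real.pi / 2))
    (hw' : w'.im ∈ Ioo (-(Real.pi / 2)) (Real.pi / 2)) (h : auxM w = auxM w') : w = w' := by
  rw [auxM, auxM, div_eq_div_iff (auxE_ne w hw) (auxE_ne w' hw')] at h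
  have h3 : Complex.exp w = Complex.exp w' := by linear_combination h / 2
  have hpi := Real.pi_pos
  rw [← Complex.log_exp (x := w) (by linarith [hw.1]) (by linarith [hw.2]), h3,
    Complex.log_exp (by linarith [hw'.1]) (by linarith [hw'.2])]

lemma auxM_near (δ : ℝ) (hδ : 0 < δ) : ∃ S : ℝ, ∀ w : ℂ, w.im ∈ Ioo (-(Real.pi / 2)) (Real.pi / 2) →
    S < w.re → ‖auxM w - 1‖ < δ := by
  refine ⟨Real.log (2 / δ + 1), fun w hw h => ?_⟩
  have h1 : auxM w - 1 = - 2 / (Complex.exp w + 1) := by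
    rw [auxM]; field_simp [auxE_ne w hw]; ring
  have h2 : 2 / δ + 1 < Real.exp w.re := (Real.log_lt_iff_lt_exp (by positivity)).1 h
  have h3 : Real.exp w.re - 1 ≤ ‖Complex.exp w + 1‖ := by
    have := norm_sub_le_norm_add (Complex.exp w) 1
    rwa [Complex.norm_exp, norm_one] at this
  have h4 : 2 / δ < ‖Complex.exp w + 1‖ := by linarith
  rw [h1, norm_div, norm_neg, Complex.norm_ofNat, div_lt_iff₀ (by linarith [div_pos two_pos hδ])]
  rw [div_lt_iff₀ hδ] at h4
  linarith

lemma auxM_surj (u : ℂ) (hu : ‖u‖ < 1) : ∃ w : ℂ, w.im ∈ Ioo (-(Real.pi / 2)) (Real.pi / 2) ∧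
    auxM w = u ∧ w.re = Real.log (‖1 + u‖ / ‖1 - u‖) := by
  have hne : (1 - u) ≠ 0 := by
    intro h
    have : u = 1 := by linear_combination -h
    simp [this] at hu
  have hne' : (1 + u) ≠ 0 := by
    intro h
    have : u = -1 := by linear_combination h
    simp [this] at hu
  have hre : 0 < ((1 + u) / (1 - u)).re := by
    rw [Complex.div_re, ← add_div]
    apply div_pos _ (Complex.normSq_pos.2 hne)
    have h1 : ‖u‖ ^ 2 < 1 := by nlinarith [norm_nonneg u]
    rw [← Complex.normSq_eq_norm_sq, Complex.normSq_apply] at h1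
    simp only [Complex.add_re, Complex.one_re, Complex.sub_re, Complex.add_im, Complex.sub_im, Complex.one_im]
    nlinarith
  refine ⟨Complex.log ((1 + u) / (1 - u)), ?_, ?_, ?_⟩
  · rw [Complex.log_im]
    exact abs_lt.1 (Complex.abs_arg_lt_pi_div_two_iff.2 (Or.inl hre))
  · rw [auxM, Complex.exp_log (div_ne_zero hne' hne)]
    field_simp
    ring
  · rw [Complex.log_re, norm_div]

lemma auxM_diff (w : ℂ) (hw : w.im ∈ Ioo (-(Real.pi / 2)) (Real.pi / 2)) : DifferentiableAt ℂ auxM w := by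
  unfold auxM
  exact (Complex.differentiable_exp.differentiableAt.sub_const 1).div
    (Complex.differentiable_exp.differentiableAt.add_const 1) (auxE_ne w hw)

lemma auxM_real (r : ℝ) (h0 : -1 < r) (h1 : r < 1) : auxM ((Real.log ((1 + r) / (1 - r)) : ℝ) : ℂ) = r := by
  have ha : 0 < 1 - r := by linarith
  have hb : 0 < 1 + r := by linarith
  rw [auxM, ← Complex.ofReal_exp, Real.exp_log (by positivity)]
  norm_cast
  field_simp
  ring

/-- finite part -/
def auxC (x : ℂ∞) : ℂ := OnePoint.elim x 0 id

lemma aux_ne_infty {x : ℂ∞} (h : x ≠ ∞) : ((auxC x : ℂ) : ℂ∞) = x := by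
  induction x using OnePoint.rec with
  | infty => exact absurd rfl h
  | coe x => rfl

lemma aux_hol (φ : ℂ → ℂ∞) (D : Set ℂ) (h : HolomorphicIntoSphereOn φ D) (z : ℂ) (hz : z ∈ D)
    (hne : φ z ≠ ∞) : DifferentiableAt ℂ (fun w => auxC (φ w)) z := by
  rcases h z hz with ⟨g, hg, he⟩ | ⟨g, hg, he⟩
  · refine hg.differentiableAt.congr_of_eventuallyEq ?_
    filter_upwards [he] with w hw
    rw [hw]; rfl
  · have hgz : g z ≠ 0 := by
      intro h0
      have := he.self_of_nhds
      rw [if_pos h0] at this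
      exact hne this
    refine (hg.differentiableAt.inv hgz).congr_of_eventuallyEq ?_
    filter_upwards [he, hg.continuousAt.eventually_ne hgz] with w hw hw'
    rw [hw, if_neg hw']; rfl

lemma aux_radial (U : Set ℂ∞) (hUopen : IsOpen U) (hinfty : ∞ ∈ U)
    (φ : ℂ → ℂ∞) (ψ : ℂ∞ → ℂ)
    (hφhol : HolomorphicIntoSphereOn φ (ball (0 : ℂ) 1))
    (hψcont : ContinuousOn ψ U)
    (hψmaps : MapsTo ψ U (ball (0 : ℂ) 1))
    (hψφ : ∀ z ∈ ball (0 : ℂ) 1, ψ (φ z) = z)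
    (hφψ : ∀ w ∈ U, φ (ψ w) = w)
    (ζ : ℂ) (hζ : ζ ∈ sphere (0 : ℂ) 1) (Γ : ℝ → ℂ∞) (hΓ : ConvergesToPrimeEnd U ψ Γ ζ)
    (c : ℂ) (ε : ℝ) (hε : 0 < ε) (T : ℝ) (hT : ∀ t ≥ T, Γ t ∉ ((↑) : ℂ → ℂ∞) '' ball c ε) :
    ∃ ρ < 1, ∀ r : ℝ, ρ < r → r < 1 → φ (ζ * r) ∉ ((↑) : ℂ → ℂ∞) '' ball c (ε / 2) := by
  have hζ1 : ‖ζ‖ = 1 := by simpa using hζ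
  have hζ0 : ζ ≠ 0 := by intro h; simp [h] at hζ1
  have hmem : ∀ w : ℂ, w.im ∈ Ioo (-(Real.pi / 2)) (Real.pi / 2) → ζ * auxM w ∈ ball (0 : ℂ) 1 := by
    intro w hw
    simpa [hζ1] using auxM_mem w hw
  -- boundedness near ζ
  obtain ⟨δ, hδ, R, hR⟩ : ∃ δ > 0, ∃ R : ℝ, ∀ z ∈ ball (0 : ℂ) 1, ‖z - ζ‖ < δ →
      φ z ≠ ∞ ∧ ‖auxC (φ z)‖ ≤ R := by
    have h1 : ContinuousAt ψ ∞ := hψcont.continuousAt (hUopen.mem_nhds hinfty)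
    have h2 : ψ ∞ ≠ ζ := by
      intro h
      have := hψmaps hinfty
      rw [h] at this
      simp [hζ1] at this
    have hd : 0 < ‖ψ ∞ - ζ‖ / 2 := by
      have := norm_pos_iff.2 (sub_ne_zero.2 h2)
      positivity
    have h3 : ψ ⁻¹' (ball (ψ ∞) (‖ψ ∞ - ζ‖ / 2)) ∈ 𝓝 (∞ : ℂ∞) := h1 (ball_mem_nhds _ hd)
    obtain ⟨s, ⟨hs1, hs2⟩, hs3⟩ := OnePoint.hasBasis_nhds_infty.mem_iff.1 h3
    obtain ⟨R, hR⟩ := hs2.isBounded.subset_closedBall 0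
    refine ⟨‖ψ ∞ - ζ‖ / 2, hd, R, fun z hz hzζ => ?_⟩
    have h4 : φ z ∉ ψ ⁻¹' (ball (ψ ∞) (‖ψ ∞ - ζ‖ / 2)) := by
      intro h
      rw [mem_preimage, hψφ z hz, mem_ball_iff_norm] at h
      have := norm_sub_le_norm_sub_add_norm_sub (ψ ∞) z ζ
      rw [norm_sub_rev (ψ ∞) z] at this
      linarith
    have h5 : φ z ∉ (↑) '' sᶜ ∪ {∞} := fun h => h4 (hs3 h)
    have h6 : φ z ≠ ∞ := fun h => h5 (Or.inr h)
    refine ⟨h6, ?_⟩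
    have h7 : auxC (φ z) ∈ s := by
      by_contra hcon
      exact h5 (Or.inl ⟨auxC (φ z), hcon, aux_ne_infty h6⟩)
    simpa using hR h7
  obtain ⟨s₀, hs₀⟩ := auxM_near δ hδ
  have hnear : ∀ w ∈ auxStrip s₀, ‖ζ * auxM w - ζ‖ < δ := by
    intro w hw
    have : ζ * auxM w - ζ = ζ * (auxM w - 1) := by ring
    rw [this, norm_mul, hζ1, one_mul]
    exact hs₀ w hw.2 hw.1
  have hfin : ∀ w ∈ auxStrip s₀, φ (ζ * auxM w) ≠ ∞ := fun w hw =>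
    (hR _ (hmem w hw.2) (hnear w hw)).1
  obtain ⟨S, hS⟩ := aux_cross (fun w => auxC (φ (ζ * auxM w))) s₀ R
    (by
      intro w hw
      have h1 := aux_hol φ _ hφhol (ζ * auxM w) (hmem w hw.2) (hfin w hw)
      have h2 : DifferentiableAt ℂ (fun w => ζ * auxM w) w := (auxM_diff w hw.2).const_mul ζ
      exact (DifferentiableAt.comp w h1 h2).differentiableWithinAt)
    (by
      intro w hw w' hw' h
      have h1 : φ (ζ * auxM w) = φ (ζ * auxM w') := by
        rw [← aux_ne_infty (hfin w hw), ← aux_ne_infty (hfin w' hw')]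
        exact congrArg _ h
      have h2 := congrArg ψ h1
      rw [hψφ _ (hmem w hw.2), hψφ _ (hmem w' hw'.2)] at h2
      exact auxM_inj w w' hw.2 hw'.2 (mul_left_cancel₀ hζ0 h2))
    (fun w hw => (hR _ (hmem w hw.2) (hnear w hw)).2) (ε / 4) (by positivity)
  -- the real-part function along the curve
  obtain ⟨⟨hΓc, hΓm⟩, hΓt⟩ := hΓ
  set T' := max T 0 with hT'
  set u : ℝ → ℂ := fun t => ψ (Γ t) / ζ with hu
  have hu1 : ∀ t ≥ T', ‖u t‖ < 1 := by
    intro t ht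
    have := hψmaps (hΓm (show t ∈ Ici (0:ℝ) from le_trans (le_max_right _ _) ht))
    simpa [hu, hζ1] using this
  have huc : ContinuousOn u (Ici T') := by
    refine ContinuousOn.div_const ?_ ζ
    refine (hψcont.comp hΓc hΓm).mono ?_
    intro t ht
    exact le_trans (le_max_right T 0) (mem_Ici.1 ht)
  have hne : ∀ t ≥ T', ‖1 - u t‖ ≠ 0 := by
    intro t ht h
    have h1 : 1 - u t = 0 := norm_eq_zero.1 h
    have : u t = 1 := by linear_combination -h1
    have h2 := hu1 t ht
    simp [this] at h2
  have hne' : ∀ t ≥ T', ‖1 + u t‖ ≠ 0 := by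
    intro t ht h
    have h1 : 1 + u t = 0 := norm_eq_zero.1 h
    have : u t = -1 := by linear_combination h1
    have h2 := hu1 t ht
    simp [this] at h2
  set g : ℝ → ℝ := fun t => Real.log (‖1 + u t‖ / ‖1 - u t‖) with hg
  have hgc : ContinuousOn g (Ici T') := by
    refine ContinuousOn.log ?_ ?_
    · exact ((continuousOn_const.add huc).norm).div ((continuousOn_const.sub huc).norm) hne
    · intro t ht
      exact div_ne_zero (hne' t ht) (hne t ht)
  have hut : Tendsto u atTop (𝓝 1) := by
    have := hΓt.div_const ζ
    rwa [div_self hζ0] at this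
  have hgt : Tendsto g atTop atTop := by
    refine Real.tendsto_log_atTop.comp ?_
    have h1 : Tendsto (fun t => ‖1 + u t‖) atTop (𝓝 2) := by
      have := (hut.const_add 1).norm
      norm_num at this
      exact this
    have h2 : Tendsto (fun t => ‖1 - u t‖) atTop (𝓝[>] 0) := by
      refine tendsto_nhdsWithin_iff.2 ⟨?_, ?_⟩
      · have := (hut.const_sub 1).norm
        simpa using this
      · filter_upwards [eventually_ge_atTop T'] with t ht
        exact lt_of_le_of_ne (norm_nonneg _) (hne t ht).symm
    have := h1.pos_mul_atTop two_pos h2.inv_tendsto_nhdsGT_zero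
    simpa [div_eq_mul_inv] using this
  have hcross : ∀ x ≥ g T', ∃ t ≥ T', g t = x := by
    intro x hx
    obtain ⟨t, ht, h⟩ := intermediate_value_Ici hgc hgt hx
    exact ⟨t, ht, h⟩
  -- conclusion on the real line
  set S' := max (max S (s₀ + 1)) (g T' + 1) with hS'
  have hreal : ∀ s : ℝ, S' ≤ s → φ (ζ * auxM s) ∉ ((↑) : ℂ → ℂ∞) '' ball c (ε / 2) := by
    intro s hs hcon
    have hsS : S ≤ s := le_trans ((le_max_left _ _).trans (le_max_left _ _)) hs
    have hss₀ : s₀ + 1 ≤ s := le_trans ((le_max_right _ _).trans (le_max_left _ _)) hs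
    have hsg : g T' + 1 ≤ s := le_trans (le_max_right _ _) hs
    obtain ⟨x, hx, hxy⟩ := hS s hsS
    obtain ⟨t, ht, hgt'⟩ := hcross x (by linarith [hx.1])
    obtain ⟨w, hw1, hw2, hw3⟩ := auxM_surj (u t) (hu1 t ht)
    have hwx : w.re = x := by rw [hw3]; exact hgt'
    have hwe : (x + w.im * Complex.I : ℂ) = w := by rw [← hwx, Complex.re_add_im]
    have h1 := hxy w.im hw1
    rw [hwe] at h1
    have hΓt' : φ (ζ * auxM w) = Γ t := by
      rw [hw2, hu, mul_div_cancel₀ _ hζ0]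
      exact hφψ _ (hΓm (show t ∈ Ici (0:ℝ) from le_trans (le_max_right _ _) ht))
    obtain ⟨q, hq, hqe⟩ := hcon
    have hqe' : auxC (φ (ζ * auxM s)) = q := by rw [← hqe]; rfl
    have hwS : w ∈ auxStrip s₀ := ⟨show s₀ < w.re by rw [hwx]; linarith [hx.1], hw1⟩
    refine hT t (le_trans (le_max_left _ _) ht) ⟨auxC (Γ t), ?_, ?_⟩
    · simp only [hΓt', hqe'] at h1
      rw [mem_ball_iff_norm] at hq ⊢
      have := norm_sub_le_norm_sub_add_norm_sub (auxC (Γ t)) q c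
      linarith
    · apply aux_ne_infty
      rw [← hΓt']
      exact hfin w hwS
  refine ⟨max 0 (1 - Real.exp (-S')), max_lt one_pos (by linarith [Real.exp_pos (-S')]), fun r hr hr1 => ?_⟩
  have hr0 : 0 < r := lt_of_le_of_lt (le_max_left _ _) hr
  have hrS : 1 - Real.exp (-S') < r := lt_of_le_of_lt (le_max_right _ _) hr
  have h1r : 0 < 1 - r := by linarith
  have := hreal (Real.log ((1 + r) / (1 - r))) (by
    rw [Real.le_log_iff_exp_le (by positivity), le_div_iff₀ h1r]
    have h1 : Real.exp S' * (1 - r) ≤ Real.exp S' * Real.exp (-S') := by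
      gcongr; linarith
    rw [← Real.exp_add, add_neg_cancel, Real.exp_zero] at h1
    linarith)
  rwa [auxM_real r (by linarith) hr1] at this

lemma aux_final (σ : ℝ) (hσ : σ * σ = 1) (U : Set ℂ∞) (hUopen : IsOpen U) (hinfty : ∞ ∈ U)
    (φ : ℂ → ℂ∞) (ψ : ℂ∞ → ℂ)
    (hφcont : ContinuousOn φ (ball (0 : ℂ) 1))
    (hφmaps : MapsTo φ (ball (0 : ℂ) 1) U)
    (hφhol : HolomorphicIntoSphereOn φ (ball (0 : ℂ) 1))
    (hψcont : ContinuousOn ψ U)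
    (hψmaps : MapsTo ψ U (ball (0 : ℂ) 1))
    (hψφ : ∀ z ∈ ball (0 : ℂ) 1, ψ (φ z) = z)
    (hφψ : ∀ w ∈ U, φ (ψ w) = w)
    (ζ : ℂ) (hζ : ζ ∈ sphere (0 : ℂ) 1)
    (z₀ : ℂ∞) (hz₀I : z₀ ∈ impression φ ζ) (hsm : StronglyMinimal U ψ ζ z₀)
    (w : ℂ∞) (hwz : w ≠ z₀) (Γ₀ : ℝ → ℂ∞) (hΓ₀ : ConvergesToPrimeEnd U ψ Γ₀ ζ)
    (hside : ∀ᶠ t in atTop, 0 ≤ σ * (ψ (Γ₀ t) / ζ).im) (hacc : w ∈ accSet Γ₀) :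
    ∃ Γ : ℝ → ℂ∞, ConvergesToPrimeEnd U ψ Γ ζ ∧ (∀ᶠ t in atTop, 0 ≤ σ * (ψ (Γ t) / ζ).im) ∧
      w ∈ accSet Γ ∧ z₀ ∉ accSet Γ := by
  have hζ1 : ‖ζ‖ = 1 := by simpa using hζ
  have hζ0 : ζ ≠ 0 := by intro h; simp [h] at hζ1
  have hUlim : ∀ z ∈ U, ψ z ≠ ζ := by
    intro z hz h
    have := hψmaps hz
    rw [h] at this
    simp [hζ1] at this
  -- z₀ is finite
  have hz₀U : z₀ ∉ U := by
    intro hz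
    obtain ⟨v, hv, hvζ, hvz⟩ := hz₀I
    have h1 : Tendsto (fun j => ψ (φ (v j))) atTop (𝓝 (ψ z₀)) :=
      (hψcont.continuousAt (hUopen.mem_nhds hz)).tendsto.comp hvz
    simp only [hψφ _ (hv _)] at h1
    exact hUlim z₀ hz (tendsto_nhds_unique h1 hvζ)
  have hz₀ne : z₀ ≠ ∞ := fun h => hz₀U (h ▸ hinfty)
  obtain ⟨c, hc⟩ : ∃ c : ℂ, (c : ℂ∞) = z₀ := ⟨_, aux_ne_infty hz₀ne⟩
  have hnhds : ∀ ε > 0, ((↑) : ℂ → ℂ∞) '' ball c ε ∈ 𝓝 z₀ := by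
    intro ε hε
    rw [← hc, OnePoint.nhds_coe_eq]
    exact image_mem_map (ball_mem_nhds _ hε)
  -- the sequence
  obtain ⟨t, ht, htw⟩ := hacc
  obtain ⟨N, hN⟩ := eventually_atTop.1 ((ht.eventually (eventually_ge_atTop 0)).and (ht.eventually hside))
  have htN : Tendsto (fun j => t (j + N)) atTop atTop := ht.comp (tendsto_add_atTop_nat N)
  have hwlim : Tendsto (fun j => Γ₀ (t (j + N))) atTop (𝓝 w) := htw.comp (tendsto_add_atTop_nat N)
  have hwU : ∀ j, Γ₀ (t (j + N)) ∈ U := fun j => hΓ₀.1.2 (hN (j + N) (by omega)).1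
  have hwψ : Tendsto (fun j => ψ (Γ₀ (t (j + N)))) atTop (𝓝 ζ) := hΓ₀.2.comp htN
  obtain ⟨Γ, hΓ, hthru, hz₀Γ⟩ := hsm (fun j => Γ₀ (t (j + N))) hwU hwψ (by
    rintro ⟨n, hn, hlim⟩
    exact hwz (tendsto_nhds_unique (hwlim.comp hn.tendsto_atTop) hlim))
  -- Γ avoids a neighbourhood
  obtain ⟨ε, hε, T, hT⟩ : ∃ ε > 0, ∃ T : ℝ, ∀ t ≥ T, Γ t ∉ ((↑) : ℂ → ℂ∞) '' ball c ε := by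
    by_contra! hcon
    have h1 : ∀ n : ℕ, ∃ t : ℝ, (n : ℝ) ≤ t ∧ Γ t ∈ ((↑) : ℂ → ℂ∞) '' ball c (1 / ((n : ℝ) + 1)) := by
      intro n
      obtain ⟨t, h, h'⟩ := hcon (1 / ((n : ℝ) + 1)) (by positivity) n
      exact ⟨t, h, h'⟩
    choose τ hτ1 q hq hqe using h1
    refine hz₀Γ ⟨τ, tendsto_atTop_mono hτ1 tendsto_natCast_atTop_atTop, ?_⟩
    simp only [← hqe]
    rw [← hc]
    refine (OnePoint.continuous_coe.tendsto c).comp ?_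
    rw [tendsto_iff_dist_tendsto_zero]
    exact squeeze_zero (fun _ => dist_nonneg) (fun n => (mem_ball.1 (hq n)).le) tendsto_one_div_add_atTop_nhds_zero_nat
  obtain ⟨ρ, hρ1, hρ⟩ := aux_radial U hUopen hinfty φ ψ hφhol hψcont hψmaps hψφ hφψ ζ hζ Γ hΓ c ε hε T hT
  -- projection
  set P : ℂ → ℂ := fun u => (u.re : ℂ) + ((σ * max (σ * u.im) 0 : ℝ) : ℂ) * Complex.I with hP
  have hPre : ∀ u, (P u).re = u.re := by intro u; simp [hP]
  have hPim : ∀ u, (P u).im = σ * max (σ * u.im) 0 := by intro u; simp [hP]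
  have hPc : Continuous P := by fun_prop
  have hPpos : ∀ u : ℂ, 0 ≤ σ * u.im → P u = u := by
    intro u hu
    apply Complex.ext
    · exact hPre u
    · rw [hPim, max_eq_left hu, ← mul_assoc, hσ, one_mul]
  have hPneg : ∀ u : ℂ, σ * u.im ≤ 0 → P u = (u.re : ℂ) := by
    intro u hu
    apply Complex.ext
    · simp [hPre u]
    · rw [hPim, max_eq_right hu]; simp
  have hPside : ∀ u : ℂ, 0 ≤ σ * (P u).im := by
    intro u
    rw [hPim, ← mul_assoc, hσ, one_mul]
    exact le_max_right _ _
  have hPn : ∀ u : ℂ, ‖P u‖ ≤ ‖u‖ := by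
    intro u
    rcases le_total 0 (σ * u.im) with h | h
    · rw [hPpos u h]
    · rw [hPneg u h, Complex.norm_real]
      exact Complex.abs_re_le_norm u
  set v : ℝ → ℂ := fun t => ζ * P (ψ (Γ t) / ζ) with hv
  have hvball : ∀ t, 0 ≤ t → v t ∈ ball (0 : ℂ) 1 := by
    intro t ht
    have h1 := hψmaps (hΓ.1.2 (show t ∈ Ici (0:ℝ) from ht))
    have h2 := hPn (ψ (Γ t) / ζ)
    rw [norm_div, hζ1, div_one] at h2
    rw [mem_ball_zero_iff] at h1 ⊢
    rw [hv]
    simp only [norm_mul, hζ1, one_mul]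
    exact h2.trans_lt h1
  have hvψ : ∀ t, 0 ≤ t → ψ (φ (v t)) = v t := fun t ht => hψφ _ (hvball t ht)
  have hut : Tendsto (fun t => ψ (Γ t) / ζ) atTop (𝓝 1) := by
    have := hΓ.2.div_const ζ
    rwa [div_self hζ0] at this
  have hP1 : P 1 = 1 := by rw [hPpos 1 (by simp)]
  have hvlim : Tendsto v atTop (𝓝 ζ) := by
    have := ((hPc.tendsto 1).comp hut).const_mul ζ
    rw [hP1, mul_one] at this
    exact this
  have hψΓc : ContinuousOn (fun t => ψ (Γ t)) (Ici 0) := hψcont.comp hΓ.1.1 hΓ.1.2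
  refine ⟨fun t => φ (v t), ⟨⟨?_, ?_⟩, ?_⟩, ?_, ?_, ?_⟩
  · refine hφcont.comp ?_ (fun t ht => hvball t ht)
    exact continuousOn_const.mul (hPc.comp_continuousOn (hψΓc.div_const ζ))
  · exact fun t ht => hφmaps (hvball t ht)
  · refine hvlim.congr' ?_
    filter_upwards [eventually_ge_atTop 0] with t ht
    exact (hvψ t ht).symm
  · filter_upwards [eventually_ge_atTop 0] with t ht
    rw [hvψ t ht, hv]
    simp only [mul_div_cancel_left₀ _ hζ0]
    exact hPside _
  · choose s hs0 hs using hthru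
    refine ⟨s, ?_, ?_⟩
    · rw [Filter.tendsto_atTop]
      intro M
      have hK : IsCompact ((fun t => ψ (Γ t)) '' Icc 0 M) :=
        isCompact_Icc.image_of_continuousOn (hψΓc.mono Icc_subset_Ici_self)
      have hζK : ζ ∉ (fun t => ψ (Γ t)) '' Icc 0 M := by
        rintro ⟨t, ht, h⟩
        exact hUlim _ (hΓ.1.2 (show t ∈ Ici (0:ℝ) from ht.1)) h
      filter_upwards [hwψ.eventually (hK.isClosed.isOpen_compl.mem_nhds hζK)] with j hj
      by_contra! hlt
      exact hj ⟨s j, ⟨hs0 j, hlt.le⟩, by simp only [hs j]⟩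
    · refine hwlim.congr ?_
      intro j
      have h1 : v (s j) = ψ (Γ₀ (t (j + N))) := by
        rw [hv]
        simp only [hs j]
        rw [hPpos _ (hN (j + N) (by omega)).2, mul_div_cancel₀ _ hζ0]
      show _ = φ (v (s j))
      rw [h1, hφψ _ (hwU j)]
  · rintro ⟨s, hs, hlim⟩
    have hev : ∀ᶠ t in atTop, φ (v t) ∉ ((↑) : ℂ → ℂ∞) '' ball c (ε / 2) := by
      have hre : Tendsto (fun t => (ψ (Γ t) / ζ).re) atTop (𝓝 1) := by
        have := (Complex.continuous_re.tendsto 1).comp hut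
        rw [Complex.one_re] at this
        exact this
      filter_upwards [eventually_ge_atTop T, eventually_ge_atTop 0, hre.eventually (Ioi_mem_nhds hρ1)] with t htT ht0 htρ
      have hU := hΓ.1.2 (show t ∈ Ici (0:ℝ) from ht0)
      rcases le_total 0 (σ * (ψ (Γ t) / ζ).im) with h | h
      · have h1 : v t = ψ (Γ t) := by
          rw [hv]
          simp only
          rw [hPpos _ h, mul_div_cancel₀ _ hζ0]
        rw [h1, hφψ _ hU]
        exact fun hcon => hT t htT (image_mono (ball_subset_ball (by linarith)) hcon)
      · have h1 : v t = ζ * ((ψ (Γ t) / ζ).re : ℂ) := by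
          rw [hv]
          simp only
          rw [hPneg _ h]
        rw [h1]
        refine hρ _ htρ ?_
        have h2 := hψmaps hU
        rw [mem_ball_zero_iff] at h2
        refine (Complex.re_le_norm _).trans_lt ?_
        rwa [norm_div, hζ1, div_one]
    obtain ⟨j, hj1, hj2⟩ := ((hs.eventually hev).and (hlim.eventually (hnhds (ε / 2) (by positivity)))).exists
    exact hj1 hj2

/-- A strongly minimal point cannot have priority over any other point of either wing. -/
theorem stmt9
    (U : Set ℂ∞) (hUopen : IsOpen U) (hUconn : IsConnected U)
    (hUsc : SimplyConnectedSpace U) (hinfty : ∞ ∈ U)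
    (hKconn : IsConnected Uᶜ) (hKnt : Set.Nontrivial Uᶜ)
    (φ : ℂ → ℂ∞) (ψ : ℂ∞ → ℂ)
    (hφcont : ContinuousOn φ (ball (0 : ℂ) 1))
    (hφmaps : MapsTo φ (ball (0 : ℂ) 1) U)
    (hφhol : HolomorphicIntoSphereOn φ (ball (0 : ℂ) 1))
    (hψcont : ContinuousOn ψ U)
    (hψmaps : MapsTo ψ U (ball (0 : ℂ) 1))
    (hψφ : ∀ z ∈ ball (0 : ℂ) 1, ψ (φ z) = z)
    (hφψ : ∀ w ∈ U, φ (ψ w) = w)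
    (ζ : ℂ) (hζ : ζ ∈ sphere (0 : ℂ) 1)
    (z₀ : ℂ∞) (hz₀I : z₀ ∈ impression φ ζ) (hsm : StronglyMinimal U ψ ζ z₀) :
    (z₀ ∈ leftWing U ψ ζ → ∀ w ∈ leftWing U ψ ζ, w ≠ z₀ →
      ∃ Γ : ℝ → ℂ∞, ConvergesFromLeft U ψ Γ ζ ∧ w ∈ accSet Γ ∧ z₀ ∉ accSet Γ) ∧
    (z₀ ∈ rightWing U ψ ζ → ∀ w ∈ rightWing U ψ ζ, w ≠ z₀ →
      ∃ Γ : ℝ → ℂ∞, ConvergesFromRight U ψ Γ ζ ∧ w ∈ accSet Γ ∧ z₀ ∉ accSet Γ) := by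
  refine ⟨?_, ?_⟩
  · rintro - w ⟨Γ₀, ⟨hΓ₀, hside⟩, hacc⟩ hne
    obtain ⟨Γ, h1, h2, h3, h4⟩ := aux_final 1 (by norm_num) U hUopen hinfty φ ψ hφcont hφmaps hφhol hψcont
      hψmaps hψφ hφψ ζ hζ z₀ hz₀I hsm w hne Γ₀ hΓ₀ (by simpa using hside) hacc
    exact ⟨Γ, ⟨h1, by simpa using h2⟩, h3, h4⟩
  · rintro - w ⟨Γ₀, ⟨hΓ₀, hside⟩, hacc⟩ hne
    obtain ⟨Γ, h1, h2, h3, h4⟩ := aux_final (-1) (by norm_num) U hUopen hinfty φ ψ hφcont hφmaps hφhol hψcont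
      hψmaps hψφ hφψ ζ hζ z₀ hz₀I hsm w hne Γ₀ hΓ₀ (by simpa using hside) hacc
    exact ⟨Γ, ⟨h1, by simpa using h2⟩, h3, h4⟩

end
end

section
/- Let Γ : [0,∞) → U be a continuous curve whose accumulation set A (the set of limits in Ĉ of sequences Γ(t_j) with t_j → ∞) satisfies A ⊆ ∂U. Let z ∈ A with z ∈ ℂ, let w ∈ (closure(U) ∩ ℂ) \ A, and let x ∈ U. Then for all sufficiently small ε > 0 the following holds: if T ≥ 0 is the minimal parameter with |Γ(T) − z| ≤ ε, then the set K₁(ε) := {p ∈ ℂ : |p − z| ≤ ε} ∪ Γ([T,∞)) ∪ A does not separate x and w in Ĉ, i.e. x and w lie in the same connected component of Ĉ \ K₁(ε). -/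
open Filter Topology Metric Set OnePoint

noncomputable section

local notation "ℂ∞" => OnePoint ℂ

lemma cg_nhds (p : ℂ∞) : (𝓝 p).IsCountablyGenerated := by
  induction p using OnePoint.rec with
  | infty =>
    rw [OnePoint.nhds_infty_eq, Filter.coclosedCompact_eq_cocompact, ← Metric.cobounded_eq_cocompact,
      ← comap_norm_atTop]
    infer_instance
  | coe c =>
    rw [OnePoint.nhds_coe_eq]
    infer_instance

lemma preconn_outer (r : ℝ) : IsPreconnected {c : ℂ | max r 0 < ‖c‖} := by
  have h : {c : ℂ | max r 0 < ‖c‖} =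
      (fun q : ℝ × ℝ => (q.1 : ℂ) * Complex.exp (q.2 * Complex.I)) '' (Ioi (max r 0) ×ˢ univ) := by
    ext c
    constructor
    · intro hc
      exact ⟨(‖c‖, c.arg), ⟨hc, trivial⟩, Complex.norm_mul_exp_arg_mul_I c⟩
    · rintro ⟨⟨a, b⟩, ⟨ha, -⟩, rfl⟩
      have ha' : max r 0 < a := ha
      have h0 : 0 < a := lt_of_le_of_lt (le_max_right _ _) ha'
      simp only [mem_setOf_eq, norm_mul, Complex.norm_exp_ofReal_mul_I, Complex.norm_real,
        Real.norm_eq_abs, abs_of_pos h0, mul_one]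
      exact ha'
  rw [h]
  exact (isPreconnected_Ioi.prod isPreconnected_univ).image _ (by fun_prop)

lemma exists_conn_nhd (p : ℂ∞) (V : Set ℂ∞) (hV : V ∈ 𝓝 p) :
    ∃ N ∈ 𝓝 p, N ⊆ V ∧ IsPreconnected N := by
  induction p using OnePoint.rec with
  | infty =>
    have h1 : ((↑) : ℂ → ℂ∞) ⁻¹' V ∈ Bornology.cobounded ℂ := by
      rw [Metric.cobounded_eq_cocompact, ← Filter.coclosedCompact_eq_cocompact]
      exact OnePoint.tendsto_coe_infty hV
    rw [← comap_norm_atTop] at h1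
    obtain ⟨S, hS, hSV⟩ := h1
    obtain ⟨r, hr⟩ := mem_atTop_sets.1 hS
    have h2 : {c : ℂ | max r 0 < ‖c‖} ∈ coclosedCompact ℂ := by
      rw [Filter.coclosedCompact_eq_cocompact, ← Metric.cobounded_eq_cocompact, ← comap_norm_atTop]
      exact preimage_mem_comap (Ioi_mem_atTop (max r 0))
    refine ⟨insert ∞ (((↑) : ℂ → ℂ∞) '' {c : ℂ | max r 0 < ‖c‖}), ?_, ?_, ?_⟩
    · rw [OnePoint.nhds_infty_eq]
      refine ⟨mem_of_superset (image_mem_map h2) (subset_insert _ _), mem_insert _ _⟩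
    · rintro q (rfl | ⟨c, hc, rfl⟩)
      · exact mem_of_mem_nhds hV
      · exact hSV (hr _ ((le_max_left _ _).trans (le_of_lt hc)))
    · refine ((preconn_outer r).image _ OnePoint.continuous_coe.continuousOn).subset_closure
        (subset_insert _ _) ?_
      rintro q (rfl | hq)
      · exact mem_closure_of_tendsto OnePoint.tendsto_coe_infty
          (mem_of_superset h2 fun c hc => mem_image_of_mem _ hc)
      · exact subset_closure hq
  | coe c =>
    rw [OnePoint.nhds_coe_eq] at hV
    obtain ⟨r, hr, hrV⟩ := Metric.mem_nhds_iff.1 (mem_map.1 hV)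
    refine ⟨((↑) : ℂ → ℂ∞) '' ball c r, ?_, image_subset_iff.2 hrV, ?_⟩
    · rw [OnePoint.nhds_coe_eq]
      exact image_mem_map (ball_mem_nhds c hr)
    · exact (convex_ball c r).isPreconnected.image _ OnePoint.continuous_coe.continuousOn

/-- Connected link between `p` and `q` which is avoided by `A`, by the tail of `Γ` and by a
neighbourhood of `z`. -/
def GoodLink (Γ : ℝ → ℂ∞) (z p q : ℂ∞) : Prop :=
  ∃ C : Set ℂ∞, IsPreconnected C ∧ p ∈ C ∧ q ∈ C ∧ (∀ y ∈ C, y ∉ accSet Γ) ∧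
    (∀ᶠ t in atTop, Γ t ∉ C) ∧ ∀ᶠ y in 𝓝 z, y ∉ C

lemma GoodLink.trans {Γ : ℝ → ℂ∞} {z p q r : ℂ∞} (h : GoodLink Γ z p q) (h' : GoodLink Γ z q r) :
    GoodLink Γ z p r := by
  obtain ⟨C, h1, h2, h3, h4, h5, h6⟩ := h
  obtain ⟨D, k1, k2, k3, k4, k5, k6⟩ := h'
  refine ⟨C ∪ D, h1.union q h3 k2 k1, Or.inl h2, Or.inr k3, ?_, ?_, ?_⟩
  · rintro y (hy | hy)
    exacts [h4 y hy, k4 y hy]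
  · filter_upwards [h5, k5] with t a b
    exact fun hh => hh.elim a b
  · filter_upwards [h6, k6] with t a b
    exact fun hh => hh.elim a b

lemma GoodLink.symm {Γ : ℝ → ℂ∞} {z p q : ℂ∞} (h : GoodLink Γ z p q) : GoodLink Γ z q p := by
  obtain ⟨C, h1, h2, h3, h4⟩ := h
  exact ⟨C, h1, h3, h2, h4⟩

lemma exists_avoid {Γ : ℝ → ℂ∞} {p : ℂ∞} (hp : p ∉ accSet Γ) :
    ∃ V ∈ 𝓝 p, ∀ᶠ t in atTop, Γ t ∉ V := by
  by_contra! hcon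
  apply hp
  haveI := cg_nhds p
  obtain ⟨B, hB⟩ := (𝓝 p).exists_antitone_basis
  have : ∀ n : ℕ, ∃ t : ℝ, (n : ℝ) ≤ t ∧ Γ t ∈ B n := by
    intro n
    have h := hcon (B n) (hB.1.mem_of_mem trivial)
    have h' : ∃ᶠ t in atTop, Γ t ∈ B n := by
      intro h2
      exact h h2
    obtain ⟨t, ht, ht'⟩ := (h'.and_eventually (eventually_ge_atTop (n : ℝ))).exists
    exact ⟨t, ht', ht⟩
  choose t ht ht' using this
  exact ⟨t, tendsto_atTop_mono ht tendsto_natCast_atTop_atTop, hB.tendsto ht'⟩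

lemma eventually_link {Γ : ℝ → ℂ∞} {z p : ℂ∞} (hz : z ∈ accSet Γ) (hp : p ∉ accSet Γ) :
    ∀ᶠ q in 𝓝 p, GoodLink Γ z p q := by
  obtain ⟨V, hV, hVt⟩ := exists_avoid hp
  have hne : p ≠ z := fun h => hp (h ▸ hz)
  obtain ⟨W, hW, Z, hZ, hWZ⟩ := Filter.disjoint_iff.1 (disjoint_nhds_nhds.2 hne)
  obtain ⟨N, hN, hNs, hNc⟩ := exists_conn_nhd p (interior V ∩ W)
    (inter_mem (interior_mem_nhds.2 hV) hW)
  filter_upwards [hN] with q hq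
  refine ⟨N, hNc, mem_of_mem_nhds hN, hq, ?_, ?_, ?_⟩
  · rintro y hy ⟨t, ht, hty⟩
    obtain ⟨j, a, b⟩ := ((ht.eventually hVt).and
      (hty.eventually (mem_interior_iff_mem_nhds.1 (hNs hy).1))).exists
    exact a b
  · filter_upwards [hVt] with t ht
    exact fun h => ht (interior_subset (hNs h).1)
  · filter_upwards [hZ] with y hy
    exact fun h => (Set.disjoint_left.1 hWZ) (hNs h).2 hy

/-- Claim 2 in the proof of the Ursell–Young theorem: for all sufficiently small `ε > 0`,
the set `K₁(ε) = closedBall z ε ∪ Γ([T,∞)) ∪ A` does not separate `x` and `w`. -/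
theorem stmt10
    (U : Set ℂ∞) (hUopen : IsOpen U) (hUne : U.Nonempty) (hUconn : IsConnected U)
    (Γ : ℝ → ℂ∞) (hΓ : IsCurveIn U Γ)
    (hA : accSet Γ ⊆ frontier U)
    (z : ℂ) (hz : (z : ℂ∞) ∈ accSet Γ)
    (w : ℂ) (hwcl : (w : ℂ∞) ∈ closure U) (hwA : (w : ℂ∞) ∉ accSet Γ)
    (x : ℂ∞) (hx : x ∈ U) :
    ∃ ε₀ > (0 : ℝ), ∀ ε : ℝ, 0 < ε → ε ≤ ε₀ →
      ∀ T : ℝ, IsLeast {t : ℝ | 0 ≤ t ∧ ∃ c : ℂ, Γ t = (c : ℂ∞) ∧ dist c z ≤ ε} T →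
        (w : ℂ∞) ∈ connectedComponentIn
          (((fun c : ℂ => (c : ℂ∞)) '' closedBall z ε ∪ Γ '' Ici T ∪ accSet Γ)ᶜ) x := by
  obtain ⟨hΓc, hΓU⟩ := hΓ
  have hdis : ∀ y ∈ U, y ∉ accSet Γ := fun y hy h => by
    have := hA h
    rw [hUopen.frontier_eq] at this
    exact this.2 hy
  obtain ⟨u, hu, huU⟩ := (mem_closure_iff_frequently.1 hwcl).and_eventually
    (eventually_link hz hwA) |>.exists
  have hlink : GoodLink Γ z x u := hUconn.isPreconnected.induction₂ (GoodLink Γ z)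
    (fun y hy => mem_nhdsWithin_of_mem_nhds (eventually_link hz (hdis y hy)))
    (fun _ _ _ _ _ _ h h' => h.trans h') (fun _ _ _ _ h => h.symm) hx hu
  obtain ⟨C, hC, hxC, hwC, hCA, hCt, hCz⟩ := hlink.trans huU.symm
  obtain ⟨R, hR⟩ := eventually_atTop.1 hCt
  have hcpt : IsCompact (Γ '' Icc 0 R) :=
    isCompact_Icc.image_of_continuousOn (hΓc.mono Icc_subset_Ici_self)
  have hzn : (z : ℂ∞) ∉ Γ '' Icc 0 R := by
    rintro ⟨t, ht, h⟩
    exact hdis _ (hΓU ht.1) (h ▸ hz)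
  have hev := hCz.and (hcpt.isClosed.isOpen_compl.mem_nhds hzn)
  rw [OnePoint.nhds_coe_eq] at hev
  obtain ⟨ε₀, hε₀, hball⟩ := Metric.nhds_basis_closedBall.mem_iff.1 (mem_map.1 hev)
  refine ⟨ε₀, hε₀, fun ε _ hle T hT => ?_⟩
  have hb : ∀ c : ℂ, dist c z ≤ ε → (c : ℂ∞) ∉ C ∧ (c : ℂ∞) ∉ Γ '' Icc 0 R :=
    fun c hc => hball (mem_closedBall.2 (hc.trans hle))
  obtain ⟨hT0, c, hc, hcz⟩ := hT.1
  have hRT : R ≤ T := by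
    by_contra! h
    exact (hb c hcz).2 (hc ▸ mem_image_of_mem Γ ⟨hT0, h.le⟩)
  refine hC.subset_connectedComponentIn hxC ?_ hwC
  rintro y hy ((⟨c, hc, rfl⟩ | ⟨t, ht, rfl⟩) | h)
  · exact (hb c (mem_closedBall.1 hc)).1 hy
  · exact hR t (hRT.trans ht) hy
  · exact hCA y hy h

end
end

section
/- Let σ : ℝ → U be an injective continuous curve that accumulates only on ∂U in both directions, i.e. for every compact set C ⊆ U there is t₀ > 0 such that σ(t) ∉ C whenever |t| ≥ t₀. Then U \ σ(ℝ) has exactly two connected components. -/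
open Filter Topology Metric Set OnePoint

noncomputable section

local notation "ℂ∞" => OnePoint ℂ

theorem aux_exp_const {X : Type*} [TopologicalSpace X] {S : Set X} (hS : IsPreconnected S)
    {g g' : X → ℂ} (hg : ContinuousOn g S) (hg' : ContinuousOn g' S)
    (he : ∀ z ∈ S, Complex.exp (g z) = Complex.exp (g' z)) {x y : X} (hx : x ∈ S) (hy : y ∈ S) :
    g x - g' x = g y - g' y := by
  have hd : IsDiscrete ((AddSubgroup.zmultiples (2 * Real.pi * Complex.I : ℂ) : Set ℂ)) :=
    ⟨NormedSpace.discreteTopology_zmultiples _⟩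
  refine hS.constant_of_mapsTo hd (f := fun z => g z - g' z) (hg.sub hg') ?_ hx hy
  intro z hz
  obtain ⟨n, hn⟩ := Complex.exp_eq_exp_iff_exists_int.1 (he z hz)
  refine AddSubgroup.mem_zmultiples_iff.2 ⟨n, ?_⟩
  simp [hn]

theorem aux_log {A : Type*} [TopologicalSpace A] [SimplyConnectedSpace A]
    [LocallyPathConnectedSpace A] (f : A → ℂ) (hf : Continuous f) (h0 : ∀ a, f a ≠ 0) :
    ∃ F : A → ℂ, Continuous F ∧ ∀ a, Complex.exp (F a) = f a := by
  obtain ⟨a₀⟩ : Nonempty A := inferInstance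
  obtain ⟨F, ⟨-, hF⟩, -⟩ := Complex.isCoveringMapOn_exp.existsUnique_continuousMap_lifts
    ⟨f, hf⟩ (a₀ := a₀) (Complex.exp_log (h0 a₀)) h0
  exact ⟨F, F.continuous, fun a => congrFun hF a⟩

theorem aux_exp_shift (ζ : ℂ) : Complex.exp (ζ + 2 * Real.pi * Complex.I) = Complex.exp ζ :=
  Complex.exp_periodic ζ

theorem aux_deg {p : ℂ} {n : ℤ} {Q : ℂ → ℂ} (hQ : ContinuousOn Q {p}ᶜ) (h0 : ∀ z ≠ p, Q z ≠ 0)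
    {r : ℝ} (hr : 0 < r) (hin : ∀ z ≠ p, ‖z - p‖ < r → Q z = (z - p) ^ n)
    {R : ℝ} (hR : 0 < R) (hout : ∀ z, R < ‖z - p‖ → Q z = 1) : n = 0 := by
  have hpe : ∀ ζ : ℂ, p + Complex.exp ζ ≠ p := fun ζ => by simp
  obtain ⟨L, hL, hLe⟩ := aux_log (fun ζ : ℂ => Q (p + Complex.exp ζ))
    (hQ.comp_continuous (by fun_prop) hpe) (fun ζ => h0 _ (hpe ζ))
  have hD : ∀ ζ ζ', L (ζ + 2 * Real.pi * Complex.I) - L ζ = L (ζ' + 2 * Real.pi * Complex.I) - L ζ' := by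
    intro ζ ζ'
    refine aux_exp_const (S := univ) isPreconnected_univ (g := fun ζ => L (ζ + 2 * Real.pi * Complex.I))
      (by fun_prop) (by fun_prop) ?_ (mem_univ _) (mem_univ _)
    intro z _
    simp only [hLe, aux_exp_shift]
  have hre : ∀ ζ : ℂ, (ζ + 2 * Real.pi * Complex.I).re = ζ.re := by intro ζ; simp
  have h1 : L (((Real.log r - 1 : ℝ) : ℂ) + 2 * Real.pi * Complex.I) - n * (((Real.log r - 1 : ℝ) : ℂ) + 2 * Real.pi * Complex.I)
     = L ((Real.log r - 1 : ℝ) : ℂ) - n * ((Real.log r - 1 : ℝ) : ℂ) := by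
    refine aux_exp_const (S := {ζ : ℂ | ζ.re < Real.log r}) (convex_halfSpace_re_lt _).isPreconnected
      (g' := fun ζ => n * ζ) hL.continuousOn (by fun_prop) ?_ ?_ ?_
    · intro ζ hζ
      rw [hLe, hin _ (hpe ζ), add_sub_cancel_left, Complex.exp_int_mul]
      rw [add_sub_cancel_left, Complex.norm_exp]
      exact (Real.lt_log_iff_exp_lt hr).1 hζ
    · show (_ : ℂ).re < _
      rw [hre]; simp
    · show (_ : ℂ).re < _
      simp
  have h2 : L (((Real.log R + 1 : ℝ) : ℂ) + 2 * Real.pi * Complex.I) - 0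
     = L ((Real.log R + 1 : ℝ) : ℂ) - 0 := by
    refine aux_exp_const (S := {ζ : ℂ | Real.log R < ζ.re}) (convex_halfSpace_re_gt _).isPreconnected
      (g' := fun ζ => 0) hL.continuousOn (by fun_prop) ?_ ?_ ?_
    · intro ζ hζ
      rw [hLe, hout _, Complex.exp_zero]
      rw [add_sub_cancel_left, Complex.norm_exp]
      exact (Real.log_lt_iff_lt_exp hR).1 hζ
    · show _ < (_ : ℂ).re
      rw [hre]; simp
    · show _ < (_ : ℂ).re
      simp
  have h3 := hD ((Real.log R + 1 : ℝ) : ℂ) ((Real.log r - 1 : ℝ) : ℂ)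
  have h4 : (n : ℂ) * (2 * Real.pi * Complex.I) = 0 := by linear_combination h2 - h3 - h1
  have h5 : (2 * Real.pi * Complex.I : ℂ) ≠ 0 := Complex.two_pi_I_ne_zero
  exact_mod_cast (mul_eq_zero.1 h4).resolve_right h5

theorem aux_nolog {U K : Set ℂ} (hU : IsOpen U) (hK : IsCompact K) (hKU : K ⊆ U) {p : ℂ}
    (hp : p ∈ K) {n : ℤ} {g : ℂ → ℂ} (hg : ContinuousOn g (U \ K))
    (he : ∀ z ∈ U \ K, Complex.exp (g z) = (z - p) ^ n) : n = 0 := by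
  classical
  obtain ⟨k, hk, hKk, hkU⟩ := exists_compact_between hK hU hKU
  obtain ⟨k', hk', hkk', hk'U⟩ := exists_compact_between hk hU hkU
  obtain ⟨ψ, hψ1, hψ0, -, -⟩ := exists_continuous_one_zero_of_isCompact hk
    (isOpen_interior (s := k')).isClosed_compl (disjoint_compl_right_iff_subset.2 hkk')
  set Q : ℂ → ℂ := fun z => if z ∈ k then (z - p) ^ n else if z ∈ k' then
    (z - p) ^ n * Complex.exp (-((1 - ψ z : ℝ) : ℂ) * g z) else 1 with hQdef
  have hQ1 : ∀ z ∈ interior k, Q z = (z - p) ^ n := fun z hz => by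
    simp [hQdef, interior_subset hz]
  have hQ2 : ∀ z ∈ U \ K, Q z = (z - p) ^ n * Complex.exp (-((1 - ψ z : ℝ) : ℂ) * g z) := by
    intro z hz
    simp only [hQdef]
    split_ifs with h1 h2
    · have : ψ z = 1 := hψ1 h1
      simp [this]
    · rfl
    · have : ψ z = 0 := hψ0 (fun h => h2 (interior_subset h))
      simp only [this]
      rw [← he z hz, ← Complex.exp_add]; simp
  have hQ3 : ∀ z ∈ k'ᶜ, Q z = 1 := by
    intro z hz
    have : z ∉ k := fun h => hz (interior_subset (hkk' h))
    have h' : z ∉ k' := hz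
    simp [hQdef, this, h']
  have hUK : IsOpen (U \ K) := hU.sdiff hK.isClosed
  have hpc : ContinuousOn (fun z : ℂ => (z - p) ^ n) {p}ᶜ := by
    intro z hz
    have : z - p ≠ 0 := sub_ne_zero.2 hz
    have hc : ContinuousAt (fun w : ℂ => w - p) z := by fun_prop
    exact (hc.zpow₀ n (Or.inl this)).continuousWithinAt
  have hne : ∀ z ≠ p, (z - p) ^ n ≠ 0 := fun z hz => zpow_ne_zero _ (sub_ne_zero.2 hz)
  have hpk : p ∈ interior k := hKk hp
  obtain ⟨r, hr, hrk⟩ := Metric.isOpen_iff.1 isOpen_interior p hpk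
  obtain ⟨R, hR, hRk⟩ := hk'.isBounded.subset_closedBall_lt 0 p
  refine aux_deg (Q := Q) (p := p) (r := r) (R := R) ?_ ?_ hr ?_ hR ?_
  · intro z hz
    refine ContinuousAt.continuousWithinAt ?_
    have hcp : ContinuousAt (fun z : ℂ => (z - p) ^ n) z :=
      (hpc z hz).continuousAt (isOpen_compl_singleton.mem_nhds hz)
    by_cases hzU : z ∈ U
    · by_cases hzK : z ∈ K
      · exact hcp.congr (by
          filter_upwards [isOpen_interior.mem_nhds (hKk hzK)] with w hw using (hQ1 w hw).symm)
      · have hgz : ContinuousAt g z := hg.continuousAt (hUK.mem_nhds ⟨hzU, hzK⟩)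
        have : ContinuousAt (fun z => (z - p) ^ n * Complex.exp (-((1 - ψ z : ℝ) : ℂ) * g z)) z := by
          refine hcp.mul ?_
          have h1 : ContinuousAt (fun z => -((1 - ψ z : ℝ) : ℂ)) z := by fun_prop
          exact (h1.mul hgz).cexp
        exact this.congr (by
          filter_upwards [hUK.mem_nhds ⟨hzU, hzK⟩] with w hw using (hQ2 w hw).symm)
    · have : z ∈ k'ᶜ := fun h => hzU (hk'U h)
      exact (continuousAt_const (y := (1 : ℂ))).congr (by
          filter_upwards [hk'.isClosed.isOpen_compl.mem_nhds this] with w hw using (hQ3 w hw).symm)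
  · intro z hz
    simp only [hQdef]
    split_ifs
    · exact hne z hz
    · exact mul_ne_zero (hne z hz) (Complex.exp_ne_zero _)
    · exact one_ne_zero
  · intro z hz hzr
    exact hQ1 z (hrk (by simpa [dist_eq_norm] using hzr))
  · intro z hz
    refine hQ3 z (fun h => ?_)
    have := hRk h
    rw [mem_closedBall, dist_eq_norm] at this
    linarith

theorem aux_punct {p : ℂ} {r : ℝ} (hr : 0 < r) {f : ℂ → ℂ}
    (hf : ContinuousOn f (ball p r \ {p})) (h0 : ∀ z ∈ ball p r \ {p}, f z ≠ 0) :
    ∃ (n : ℤ) (h : ℂ → ℂ), ContinuousOn h (ball p r \ {p}) ∧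
      ∀ z ∈ ball p r \ {p}, f z = (z - p) ^ n * Complex.exp (h z) := by
  classical
  set S : Set ℂ := {ζ : ℂ | ζ.re < Real.log r} with hS
  have hSc : Convex ℝ S := convex_halfSpace_re_lt _
  have hSo : IsOpen S := isOpen_lt Complex.continuous_re continuous_const
  have hSne : S.Nonempty := ⟨((Real.log r - 1 : ℝ) : ℂ), by show (_ : ℂ).re < _; simp⟩
  have hSsc : IsSimplyConnected S := by
    have := hSc.contractibleSpace hSne
    show SimplyConnectedSpace S
    infer_instance
  have hre : ∀ ζ : ℂ, (ζ + 2 * Real.pi * Complex.I).re = ζ.re := by intro ζ; simp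
  have hSper : ∀ ζ : ℂ, ζ + 2 * Real.pi * Complex.I ∈ S ↔ ζ ∈ S := by
    intro ζ; simp only [hS, mem_ofPred_eq, hre]
  have hSexp : ∀ ζ, ζ ∈ S ↔ p + Complex.exp ζ ∈ ball p r \ {p} := by
    intro ζ
    simp only [Set.mem_sdiff, mem_ball, dist_self_add_left, Complex.norm_exp, hS, mem_ofPred_eq,
      Real.lt_log_iff_exp_lt hr]
    simp
  have hcomp : ContinuousOn (fun ζ => f (p + Complex.exp ζ)) S :=
    hf.comp (by fun_prop) (fun ζ hζ => (hSexp ζ).1 hζ)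
  obtain ⟨L, hL, hLe⟩ := Complex.exists_continuousOn_eqOn_exp_comp hSsc hSo hcomp (by
    rintro ⟨ζ, hζ, h⟩
    exact h0 _ ((hSexp ζ).1 hζ) h)
  replace hLe : ∀ ζ ∈ S, Complex.exp (L ζ) = f (p + Complex.exp ζ) := fun ζ hζ => hLe hζ
  have hLs : ContinuousOn (fun ζ => L (ζ + 2 * Real.pi * Complex.I)) S :=
    hL.comp (by fun_prop) (fun ζ hζ => (hSper ζ).2 hζ)
  obtain ⟨ζ₀, hζ₀⟩ := hSne
  obtain ⟨n, hn⟩ := Complex.exp_eq_exp_iff_exists_int.1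
    (show Complex.exp (L (ζ₀ + 2 * Real.pi * Complex.I)) = Complex.exp (L ζ₀) by
      rw [hLe _ hζ₀, hLe _ ((hSper _).2 hζ₀), aux_exp_shift])
  have hD : ∀ ζ ∈ S, L (ζ + 2 * Real.pi * Complex.I) - L ζ = n * (2 * Real.pi * Complex.I) := by
    intro ζ hζ
    have := aux_exp_const hSc.isPreconnected hLs hL (by
      intro z hz
      rw [hLe _ hz, hLe _ ((hSper _).2 hz), aux_exp_shift]) hζ hζ₀
    rw [this, hn]; ring
  set M : ℂ → ℂ := fun ζ => if ζ ∈ S then L ζ - n * ζ else 0 with hM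
  have hMS : ∀ ζ ∈ S, M ζ = L ζ - n * ζ := fun ζ hζ => by simp [hM, hζ]
  have hMper : Function.Periodic M (2 * Real.pi * Complex.I) := by
    intro ζ
    simp only [hM, hSper]
    split_ifs with h
    · linear_combination hD ζ h
    · rfl
  have hMexp : ∀ ζ ζ' : ℂ, Complex.exp ζ = Complex.exp ζ' → M ζ = M ζ' := by
    intro ζ ζ' h
    obtain ⟨k, hk⟩ := Complex.exp_eq_exp_iff_exists_int.1 h
    rw [hk]
    exact hMper.int_mul k ζ'
  have hMc : ContinuousOn M S := by
    refine ContinuousOn.congr (f := fun ζ => L ζ - n * ζ) (hL.sub (by fun_prop)) hMS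
  refine ⟨n, fun z => M (Complex.log (z - p)), ?_, ?_⟩
  · intro z₀ hz₀
    refine ContinuousAt.continuousWithinAt ?_
    have hne : z₀ - p ≠ 0 := sub_ne_zero.2 hz₀.2
    set lg : ℂ → ℂ := fun z => Complex.log ((z - p) / (z₀ - p)) + Complex.log (z₀ - p) with hlg
    have hlg0 : lg z₀ = Complex.log (z₀ - p) := by simp [hlg, div_self hne]
    have hlgc : ContinuousAt lg z₀ := by
      refine ContinuousAt.add ?_ continuousAt_const
      refine ContinuousAt.clog (by fun_prop) ?_
      rw [div_self hne]; exact Complex.one_mem_slitPlane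
    have hS0 : lg z₀ ∈ S := by
      rw [hSexp, hlg0, Complex.exp_log hne]; simpa using hz₀
    have hcM : ContinuousAt M (lg z₀) := hMc.continuousAt (hSo.mem_nhds hS0)
    have hc : ContinuousAt (fun z => M (lg z)) z₀ := ContinuousAt.comp hcM hlgc
    refine hc.congr ?_
    filter_upwards [isOpen_compl_singleton.mem_nhds (show z₀ ∈ ({p} : Set ℂ)ᶜ from hz₀.2)] with z hz
    apply hMexp
    have hz' : z - p ≠ 0 := sub_ne_zero.2 hz
    rw [Complex.exp_log hz', hlg]
    simp only
    rw [Complex.exp_add, Complex.exp_log (div_ne_zero hz' hne), Complex.exp_log hne]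
    field_simp
  · intro z hz
    have hz' : z - p ≠ 0 := sub_ne_zero.2 hz.2
    have hzS : Complex.log (z - p) ∈ S := by
      rw [hSexp, Complex.exp_log hz']; simpa using hz
    beta_reduce
    rw [hMS _ hzS, Complex.exp_sub, hLe _ hzS, Complex.exp_int_mul, Complex.exp_log hz']
    have := zpow_ne_zero n hz'
    rw [mul_div_cancel₀ _ this]
    congr 1
    ring

/-- every nonvanishing continuous function on `U` has a logarithm -/
def HasLogs (U : Set ℂ) : Prop := ∀ f : ℂ → ℂ, ContinuousOn f U → (∀ z ∈ U, f z ≠ 0) →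
  ∃ g : ℂ → ℂ, ContinuousOn g U ∧ ∀ z ∈ U, Complex.exp (g z) = f z

theorem aux_H1 {U : Set ℂ} (hU : IsOpen U) (hlog : HasLogs U) {p : ℂ} (hp : p ∈ U) {f : ℂ → ℂ}
    (hf : ContinuousOn f (U \ {p})) (h0 : ∀ z ∈ U \ {p}, f z ≠ 0) :
    ∃ (n : ℤ) (h : ℂ → ℂ), ContinuousOn h (U \ {p}) ∧
      ∀ z ∈ U \ {p}, f z = (z - p) ^ n * Complex.exp (h z) := by
  classical
  obtain ⟨r, hr, hrU⟩ := Metric.isOpen_iff.1 hU p hp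
  have hsub : ball p r \ {p} ⊆ U \ {p} := sdiff_subset_sdiff_left hrU
  obtain ⟨n, h, hh, hfh⟩ := aux_punct hr (hf.mono hsub) (fun z hz => h0 z (hsub hz))
  -- cutoff
  obtain ⟨ψ, hψ1, hψ0, -, -⟩ := exists_continuous_one_zero_of_isCompact
    (isCompact_closedBall p (r/3)) (isOpen_ball (x := p) (ε := r/2)).isClosed_compl
    (disjoint_compl_right_iff_subset.2 (closedBall_subset_ball (by linarith)))
  set h1 : ℂ → ℂ := fun z => if z ∈ ball p r then (ψ z : ℂ) * h z else 0 with hh1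
  have hUo : IsOpen (U \ {p}) := hU.sdiff isClosed_singleton
  have hbo : IsOpen (ball p r \ {p}) := isOpen_ball.sdiff isClosed_singleton
  have h1c : ContinuousOn h1 (U \ {p}) := by
    intro z hz
    refine ContinuousAt.continuousWithinAt ?_
    by_cases hzb : z ∈ ball p r
    · have hm := hbo.mem_nhds (show z ∈ ball p r \ {p} from ⟨hzb, hz.2⟩)
      have hc : ContinuousAt (fun z => (ψ z : ℂ) * h z) z :=
        ContinuousAt.mul (by fun_prop) (hh.continuousAt hm)
      refine hc.congr ?_
      filter_upwards [hm] with w hw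
      simp only [hh1, hw.1, if_true]
    · have hz2 : z ∈ (closedBall p (r/2))ᶜ := fun h => hzb (closedBall_subset_ball (by linarith) h)
      refine (continuousAt_const (y := (0 : ℂ))).congr ?_
      filter_upwards [isClosed_closedBall.isOpen_compl.mem_nhds hz2] with w hw
      have : ψ w = 0 := hψ0 (fun h => hw (ball_subset_closedBall h))
      simp [hh1, this]
  have hzp : ∀ z ∈ U \ {p}, z - p ≠ 0 := fun z hz => sub_ne_zero.2 hz.2
  set q : ℂ → ℂ := fun z => if z = p then 1 else f z / ((z - p) ^ n * Complex.exp (h1 z)) with hq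
  have hqc : ContinuousOn q U := by
    intro z hz
    refine ContinuousAt.continuousWithinAt ?_
    by_cases hzp' : z = p
    · subst hzp'
      refine (continuousAt_const (y := (1 : ℂ))).congr ?_
      filter_upwards [ball_mem_nhds z (show 0 < r/3 by linarith)] with w hw
      simp only [hq]
      split_ifs with hwz
      · rfl
      · have hwr : w ∈ ball z r := ball_subset_ball (by linarith) hw
        have hψw : ψ w = 1 := hψ1 (ball_subset_closedBall hw)
        have e : h1 w = h w := by simp only [hh1, hψw, hwr, if_true]; simp
        rw [e, hfh w ⟨hwr, hwz⟩, div_self]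
        exact mul_ne_zero (zpow_ne_zero _ (sub_ne_zero.2 hwz)) (Complex.exp_ne_zero _)
    · have hm := hUo.mem_nhds (show z ∈ U \ {p} from ⟨hz, hzp'⟩)
      have hc1 : ContinuousAt (fun w : ℂ => w - p) z := by fun_prop
      have hne := hzp z ⟨hz, hzp'⟩
      have hc : ContinuousAt (fun z => f z / ((z - p) ^ n * Complex.exp (h1 z))) z :=
        (hf.continuousAt hm).div ((hc1.zpow₀ n (Or.inl hne)).mul (h1c.continuousAt hm).cexp)
          (mul_ne_zero (zpow_ne_zero _ hne) (Complex.exp_ne_zero _))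
      refine hc.congr ?_
      filter_upwards [hm] with w hw
      have : w ≠ p := hw.2
      simp [hq, this]
  obtain ⟨g, hg, hge⟩ := hlog q hqc (by
    intro z hz
    simp only [hq]
    split_ifs with hzp'
    · exact one_ne_zero
    · exact div_ne_zero (h0 z ⟨hz, hzp'⟩)
        (mul_ne_zero (zpow_ne_zero _ (hzp z ⟨hz, hzp'⟩)) (Complex.exp_ne_zero _)))
  refine ⟨n, fun z => h1 z + g z, h1c.add (hg.mono sdiff_subset), ?_⟩
  intro z hz
  have : z ≠ p := hz.2
  rw [Complex.exp_add, hge z hz.1]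
  simp only [hq, this, if_false]
  have h2 := zpow_ne_zero n (hzp z hz)
  have h3 := Complex.exp_ne_zero (h1 z)
  field_simp

theorem aux_MV {U : Set ℂ} (hU : IsOpen U) (hlog : HasLogs U) {p : ℂ} (hp : p ∈ U)
    {A B V : Set ℂ} (hA : IsOpen A) (hB : IsOpen B) (hAB : A ∪ B = U \ {p})
    (hV : IsOpen V) (hVW : V ⊆ A ∩ B) (hV' : IsOpen ((A ∩ B) \ V)) :
    ∃ (n : ℤ) (g g' : ℂ → ℂ), ContinuousOn g A ∧ ContinuousOn g' B ∧
      (∀ z ∈ A, Complex.exp (g z) = (z - p) ^ n) ∧ (∀ z ∈ B, Complex.exp (g' z) = (z - p) ^ n) ∧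
      (∀ z ∈ V, g z - g' z = 2 * Real.pi * Complex.I) ∧
      (∀ z ∈ (A ∩ B) \ V, g z - g' z = 0) := by
  classical
  have hpA : p ∈ Aᶜ := fun h => (hAB.subset (Or.inl h)).2 rfl
  have hpB : p ∈ Bᶜ := fun h => (hAB.subset (Or.inr h)).2 rfl
  set a : ℂ → ℝ := fun z => infDist z Aᶜ
  set b : ℂ → ℝ := fun z => infDist z Bᶜ
  have ha : Continuous a := continuous_infDist_pt _
  have hb : Continuous b := continuous_infDist_pt _
  have ha0 : ∀ z, 0 ≤ a z := fun z => infDist_nonneg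
  have hb0 : ∀ z, 0 ≤ b z := fun z => infDist_nonneg
  have hapos : ∀ z ∈ A, 0 < a z := fun z hz =>
    (hA.isClosed_compl.notMem_iff_infDist_pos ⟨p, hpA⟩).1 (by simpa using hz)
  have hbpos : ∀ z ∈ B, 0 < b z := fun z hz =>
    (hB.isClosed_compl.notMem_iff_infDist_pos ⟨p, hpB⟩).1 (by simpa using hz)
  have haz : ∀ z ∉ A, a z = 0 := fun z hz => infDist_zero_of_mem hz
  have hbz : ∀ z ∉ B, b z = 0 := fun z hz => infDist_zero_of_mem hz
  -- generic continuity
  have key : ∀ (A B : Set ℂ) (a b : ℂ → ℝ), IsOpen A → IsOpen B → Continuous a → Continuous b →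
      (∀ z, 0 ≤ a z) → (∀ z, 0 ≤ b z) → (∀ z ∈ A, 0 < a z) → (∀ z ∉ B, b z = 0) →
      V ⊆ A ∩ B → IsOpen ((A ∩ B) \ V) →
      ContinuousOn (fun z => if z ∈ V then b z / (a z + b z) else 0) A := by
    intro A B a b hA hB ha hb ha0 hb0 hapos hbz hVW hV' z hz
    refine ContinuousAt.continuousWithinAt ?_
    have hpos : a z + b z ≠ 0 := by have := hapos z hz; have := hb0 z; linarith
    have hc : ContinuousAt (fun z => b z / (a z + b z)) z :=
      hb.continuousAt.div (by fun_prop) hpos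
    by_cases hzB : z ∈ B
    · by_cases hzV : z ∈ V
      · refine hc.congr ?_
        filter_upwards [hV.mem_nhds hzV] with w hw
        simp [hw]
      · refine (continuousAt_const (y := (0 : ℝ))).congr ?_
        filter_upwards [hV'.mem_nhds (show z ∈ (A ∩ B) \ V from ⟨⟨hz, hzB⟩, hzV⟩)] with w hw
        simp [hw.2]
    · have hzV : z ∉ V := fun h => hzB (hVW h).2
      have h0 : b z / (a z + b z) = 0 := by rw [hbz z hzB]; simp
      unfold ContinuousAt at hc ⊢
      simp only [hzV, if_false]
      beta_reduce at hc
      rw [h0] at hc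
      refine squeeze_zero (fun w => ?_) (fun w => ?_) hc
      · have := ha0 w; have := hb0 w
        split_ifs <;> positivity
      · have := ha0 w; have := hb0 w
        split_ifs
        · exact le_rfl
        · positivity
  set φ : ℂ → ℝ := fun z => if z ∈ V then b z / (a z + b z) else 0 with hφ
  set θ : ℂ → ℝ := fun z => if z ∈ V then a z / (b z + a z) else 0 with hθ
  have hφc : ContinuousOn φ A := key A B a b hA hB ha hb ha0 hb0 hapos hbz hVW hV'
  have hθc : ContinuousOn θ B := key B A b a hB hA hb ha hb0 ha0 hbpos haz
    (by rwa [inter_comm]) (by rwa [inter_comm])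
  have hsum : ∀ z ∈ V, φ z + θ z = 1 := by
    intro z hz
    have h1 := hapos z (hVW hz).1
    have h2 := hbpos z (hVW hz).2
    simp only [hφ, hθ, hz, if_true]
    field_simp
    ring
  have hφ0 : ∀ z ∉ V, φ z = 0 := fun z hz => by simp [hφ, hz]
  have hθ0 : ∀ z ∉ V, θ z = 0 := fun z hz => by simp [hθ, hz]
  set c : ℂ := 2 * Real.pi * Complex.I with hc
  have hcφ : ContinuousOn (fun z => c * (φ z : ℂ)) A :=
    continuousOn_const.mul (Complex.continuous_ofReal.comp_continuousOn hφc)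
  have hcθ : ContinuousOn (fun z => -(c * (θ z : ℂ))) B :=
    (continuousOn_const.mul (Complex.continuous_ofReal.comp_continuousOn hθc)).neg
  set f : ℂ → ℂ := fun z => if z ∈ A then Complex.exp (c * φ z) else Complex.exp (-(c * θ z)) with hf
  have hfA : ∀ z ∈ A, f z = Complex.exp (c * φ z) := fun z hz => by simp [hf, hz]
  have hfB : ∀ z ∈ B, f z = Complex.exp (-(c * θ z)) := by
    intro z hz
    simp only [hf]
    split_ifs with h
    · by_cases hzV : z ∈ V
      · have : (φ z : ℂ) = 1 - θ z := by
          have : (φ z : ℂ) + θ z = 1 := by exact_mod_cast hsum z hzV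
          linear_combination this
        rw [this, show c * (1 - (θ z : ℂ)) = -(c * θ z) + 2 * Real.pi * Complex.I by rw [hc]; ring,
          aux_exp_shift]
      · simp [hφ0 z hzV, hθ0 z hzV]
    · rfl
  have hfc : ContinuousOn f (U \ {p}) := by
    rw [← hAB]
    refine ContinuousOn.union_of_isOpen ?_ ?_ hA hB
    · exact (hcφ.cexp).congr hfA
    · exact (hcθ.cexp).congr hfB
  obtain ⟨n, h, hh, hfh⟩ := aux_H1 hU hlog hp hfc (by
    intro z hz
    simp only [hf]
    split_ifs <;> exact Complex.exp_ne_zero _)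
  have hAs : A ⊆ U \ {p} := hAB ▸ subset_union_left
  have hBs : B ⊆ U \ {p} := hAB ▸ subset_union_right
  refine ⟨n, fun z => c * φ z - h z, fun z => -(c * θ z) - h z, hcφ.sub (hh.mono hAs),
    hcθ.sub (hh.mono hBs), ?_, ?_, ?_, ?_⟩
  · intro z hz
    rw [Complex.exp_sub, ← hfA z hz, hfh z (hAs hz), mul_div_cancel_right₀ _ (Complex.exp_ne_zero _)]
  · intro z hz
    rw [Complex.exp_sub, ← hfB z hz, hfh z (hBs hz), mul_div_cancel_right₀ _ (Complex.exp_ne_zero _)]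
  · intro z hz
    have : (φ z : ℂ) + θ z = 1 := by exact_mod_cast hsum z hz
    linear_combination c * this
  · intro z hz
    simp [hφ0 z hz.2, hθ0 z hz.2]

theorem aux_compl_open {W : Set ℂ} (hW : IsOpen W) (x : ℂ) :
    IsOpen (W \ connectedComponentIn W x) := by
  rw [isOpen_iff_mem_nhds]
  intro y hy
  filter_upwards [hW.connectedComponentIn.mem_nhds (mem_connectedComponentIn hy.1)] with z hz
  refine ⟨connectedComponentIn_subset _ _ hz, fun hzx => hy.2 ?_⟩
  rw [connectedComponentIn_eq hzx, ← connectedComponentIn_eq hz]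
  exact mem_connectedComponentIn hy.1

theorem aux_precon {W : Set ℂ} (h : ∀ x ∈ W, ∀ y ∈ W, y ∈ connectedComponentIn W x) :
    IsPreconnected W := by
  refine isPreconnected_of_forall_pair (fun x hx y hy => ?_)
  exact ⟨_, connectedComponentIn_subset _ _, mem_connectedComponentIn hx, h x hx y hy,
    isPreconnected_connectedComponentIn⟩

theorem aux_cpt {W : Set ℂ} (hW : IsOpen W) (hc : IsPreconnected W) {x y : ℂ} (hx : x ∈ W)
    (hy : y ∈ W) : ∃ S : Set ℂ, IsCompact S ∧ IsPreconnected S ∧ x ∈ S ∧ y ∈ S ∧ S ⊆ W := by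
  have hp : IsPathConnected W := hW.isConnected_iff_isPathConnected.1 ⟨⟨x, hx⟩, hc⟩
  obtain ⟨γ, hγ⟩ := hp.joinedIn x hx y hy
  refine ⟨range γ, isCompact_range γ.continuous, isPreconnected_range γ.continuous,
    ⟨0, by simp⟩, ⟨1, by simp⟩, ?_⟩
  rintro _ ⟨t, rfl⟩
  exact hγ t

theorem aux_split {U : Set ℂ} (hU : IsOpen U) (hlog : HasLogs U) {K1 K2 : Set ℂ}
    (hK1 : IsCompact K1) (hK1U : K1 ⊆ U) (hK2 : IsOpen (U \ K2)) {p : ℂ} (hK : K1 ∩ K2 = {p})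
    {x y : ℂ} (hx : x ∈ U \ (K1 ∪ K2)) (hy : y ∈ U \ (K1 ∪ K2))
    (h1 : y ∈ connectedComponentIn (U \ K1) x) (h2 : y ∈ connectedComponentIn (U \ K2) x) :
    y ∈ connectedComponentIn (U \ (K1 ∪ K2)) x := by
  by_contra hcon
  have hpK : p ∈ K1 ∩ K2 := hK ▸ mem_singleton p
  have hW : (U \ K1) ∩ (U \ K2) = U \ (K1 ∪ K2) := by
    ext z; simp only [mem_inter_iff, Set.mem_sdiff, mem_union]; tauto
  have hA : IsOpen (U \ K1) := hU.sdiff hK1.isClosed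
  have hAB : (U \ K1) ∪ (U \ K2) = U \ {p} := by
    rw [← hK]; ext z; simp only [mem_inter_iff, Set.mem_sdiff, mem_union]; tauto
  have hWo : IsOpen (U \ (K1 ∪ K2)) := hW ▸ hA.inter hK2
  obtain ⟨n, g, g', hg, hg', he, he', hV, hV'⟩ := aux_MV hU hlog (hK1U hpK.1) hA hK2 hAB
    (V := connectedComponentIn (U \ (K1 ∪ K2)) x) hWo.connectedComponentIn
    (hW ▸ connectedComponentIn_subset _ _) (hW ▸ aux_compl_open hWo x)
  have hn := aux_nolog hU hK1 hK1U hpK.1 hg he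
  subst hn
  have e1 : g x - 0 = g y - 0 := by
    refine aux_exp_const (S := connectedComponentIn (U \ K1) x) (g' := fun _ => 0)
      isPreconnected_connectedComponentIn (hg.mono (connectedComponentIn_subset _ _))
      continuousOn_const (fun z hz => ?_) (mem_connectedComponentIn ?_) h1
    · rw [he z (connectedComponentIn_subset _ _ hz)]; simp
    · rw [← hW] at hx; exact hx.1
  have e2 : g' x - 0 = g' y - 0 := by
    refine aux_exp_const (S := connectedComponentIn (U \ K2) x) (g' := fun _ => 0)
      isPreconnected_connectedComponentIn (hg'.mono (connectedComponentIn_subset _ _))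
      continuousOn_const (fun z hz => ?_) (mem_connectedComponentIn ?_) h2
    · rw [he' z (connectedComponentIn_subset _ _ hz)]; simp
    · rw [← hW] at hx; exact hx.2
  have e3 := hV x (mem_connectedComponentIn hx)
  have e4 := hV' y (by rw [hW]; exact ⟨hy, hcon⟩)
  exact Complex.two_pi_I_ne_zero (by linear_combination e4 - e3 + e1 - e2)

theorem aux_punct_conn {p : ℂ} {r : ℝ} (hr : 0 < r) : IsConnected (ball p r \ {p}) := by
  have : ball p r \ {p} = (fun ζ => p + Complex.exp ζ) '' {ζ : ℂ | ζ.re < Real.log r} := by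
    ext z
    constructor
    · rintro ⟨hz, hzp⟩
      have hzp' : z - p ≠ 0 := sub_ne_zero.2 hzp
      refine ⟨Complex.log (z - p), ?_, by simp [Complex.exp_log hzp']⟩
      show (_ : ℂ).re < _
      rw [Complex.log_re]
      rw [mem_ball, dist_eq_norm] at hz
      exact Real.log_lt_log (norm_pos_iff.2 hzp') hz
    · rintro ⟨ζ, hζ, rfl⟩
      refine ⟨?_, by simp⟩
      rw [mem_ball, dist_self_add_left, Complex.norm_exp]
      exact (Real.lt_log_iff_exp_lt hr).1 hζ
  rw [this]
  refine IsConnected.image ⟨⟨((Real.log r - 1 : ℝ) : ℂ), ?_⟩, (convex_halfSpace_re_lt _).isPreconnected⟩ _ (by fun_prop)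
  show (_ : ℂ).re < _; simp

theorem aux_remove {U : Set ℂ} (hU : IsOpen U) (hc : IsPreconnected U) (p : ℂ) :
    IsPreconnected (U \ {p}) := by
  by_cases hp : p ∈ U
  swap
  · rwa [sdiff_singleton_eq_self hp]
  obtain ⟨r, hr, hrU⟩ := Metric.isOpen_iff.1 hU p hp
  have hD := aux_punct_conn (p := p) hr
  have hsub : ball p r \ {p} ⊆ U \ {p} := sdiff_subset_sdiff_left hrU
  have hUo : IsOpen (U \ {p}) := hU.sdiff isClosed_singleton
  refine aux_precon (fun x hx y hy => ?_)
  by_contra hcon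
  obtain ⟨q, hq⟩ := hD.nonempty
  set V := connectedComponentIn (U \ {p}) x with hV
  have hVo : IsOpen V := hUo.connectedComponentIn
  have hV's := aux_compl_open hUo x
  rw [← hV] at hV's
  have hVs : V ⊆ U \ {p} := connectedComponentIn_subset _ _
  have hxV : x ∈ V := mem_connectedComponentIn hx
  by_cases hqV : q ∈ V
  · have hDV : ball p r \ {p} ⊆ V := by
      rw [hV, connectedComponentIn_eq hqV]
      exact hD.isPreconnected.subset_connectedComponentIn hq hsub
    obtain ⟨z, hz, h1, h2⟩ := hc (V ∪ ball p r) ((U \ {p}) \ V) (hVo.union isOpen_ball) hV's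
      (by
        intro z hz
        by_cases hzp : z = p
        · subst hzp; exact Or.inl (Or.inr (mem_ball_self hr))
        · by_cases hzV : z ∈ V
          · exact Or.inl (Or.inl hzV)
          · exact Or.inr ⟨⟨hz, hzp⟩, hzV⟩) ⟨x, hx.1, Or.inl hxV⟩ ⟨y, hy.1, hy, hcon⟩
    rcases h1 with h1 | h1
    · exact h2.2 h1
    · exact h2.2 (hDV ⟨h1, h2.1.2⟩)
  · have hDV : ∀ z ∈ ball p r \ {p}, z ∉ V := by
      intro z hz hzV
      apply hqV
      rw [hV, connectedComponentIn_eq hzV]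
      exact hD.isPreconnected.subset_connectedComponentIn hz hsub hq
    obtain ⟨z, hz, h1, h2⟩ := hc V ((U \ {p}) \ V ∪ ball p r) hVo (hV's.union isOpen_ball)
      (by
        intro z hz
        by_cases hzp : z = p
        · subst hzp; exact Or.inr (Or.inr (mem_ball_self hr))
        · by_cases hzV : z ∈ V
          · exact Or.inl hzV
          · exact Or.inr (Or.inl ⟨⟨hz, hzp⟩, hzV⟩)) ⟨x, hx.1, hxV⟩ ⟨y, hy.1, Or.inl ⟨hy, hcon⟩⟩
    rcases h2 with h2 | h2
    · exact h2.2 h1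
    · exact hDV z ⟨h2, (hVs h1).2⟩ h1

theorem aux_arc {U : Set ℂ} (hU : IsOpen U) (hc : IsPreconnected U) (hlog : HasLogs U)
    {σ : ℝ → ℂ} (hσ : Continuous σ) (hi : Function.Injective σ) (hσU : ∀ t, σ t ∈ U)
    {a b : ℝ} (hab : a ≤ b) {x y : ℂ} (hx : x ∈ U \ σ '' Icc a b) (hy : y ∈ U \ σ '' Icc a b) :
    y ∈ connectedComponentIn (U \ σ '' Icc a b) x := by
  have hne : ∀ c : Icc a b, x ∈ U \ {σ c} ∧ y ∈ U \ {σ c} := fun c =>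
    ⟨⟨hx.1, fun h => hx.2 ⟨c, c.2, h.symm⟩⟩, ⟨hy.1, fun h => hy.2 ⟨c, c.2, h.symm⟩⟩⟩
  have hS : ∀ c : Icc a b, ∃ S : Set ℂ, IsCompact S ∧ IsPreconnected S ∧ x ∈ S ∧ y ∈ S ∧ S ⊆ U \ {σ c} :=
    fun c => aux_cpt (hU.sdiff isClosed_singleton) (aux_remove hU hc _) (hne c).1 (hne c).2
  choose S hSc hSp hxS hyS hSs using hS
  obtain ⟨t, ht0, htm, ⟨m, htb⟩, hti⟩ := exists_monotone_Icc_subset_open_cover_Icc hab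
    (c := fun c => (fun s : Icc a b => σ s) ⁻¹' (S c)ᶜ)
    (fun c => (hSc c).isClosed.isOpen_compl.preimage (by fun_prop))
    (fun s _ => mem_iUnion.2 ⟨s, fun h => (hSs s h).2 rfl⟩)
  have hsm : ∀ {s u : ℝ}, a ≤ s → u ≤ b → σ '' Icc s u ⊆ σ '' Icc a b := fun h h' =>
    image_mono (Icc_subset_Icc h h')
  have hloc : ∀ n, y ∈ connectedComponentIn (U \ σ '' Icc (t n : ℝ) (t (n+1))) x := by
    intro n
    obtain ⟨c, hcn⟩ := hti n
    refine (hSp c).subset_connectedComponentIn (hxS c) ?_ (hyS c)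
    intro z hz
    refine ⟨(hSs c hz).1, ?_⟩
    rintro ⟨s, hs, rfl⟩
    exact hcn (show (⟨s, (t n).2.1.trans hs.1, hs.2.trans (t (n+1)).2.2⟩ : Icc a b) ∈ Icc (t n) (t (n+1)) from hs) hz
  have hall : ∀ n, y ∈ connectedComponentIn (U \ σ '' Icc a (t n)) x := by
    intro n
    induction n with
    | zero =>
      refine connectedComponentIn_mono x ?_ (hloc 0)
      refine sdiff_subset_sdiff_right (image_mono ?_)
      rw [ht0]
      exact Icc_subset_Icc_right (t 1).2.1
    | succ n ih =>
      have hle : (t n : ℝ) ≤ t (n+1) := htm (Nat.le_succ n)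
      have hun : σ '' Icc a (t n) ∪ σ '' Icc (t n : ℝ) (t (n+1)) = σ '' Icc a (t (n+1)) := by
        rw [← image_union, Icc_union_Icc_eq_Icc (t n).2.1 hle]
      rw [← hun]
      have hs := hsm le_rfl (t (n+1)).2.2
      rw [← hun] at hs
      refine aux_split hU hlog (isCompact_Icc.image hσ) ?_
        (hU.sdiff (isCompact_Icc.image hσ).isClosed) (p := σ (t n)) ?_
        (sdiff_subset_sdiff_right hs hx) (sdiff_subset_sdiff_right hs hy) ih (hloc n)
      · rintro _ ⟨s, -, rfl⟩; exact hσU s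
      · rw [← image_inter hi, Icc_inter_Icc_eq_singleton (t n).2.1 hle, image_singleton]
  have := hall m
  rwa [htb m le_rfl] at this

theorem aux_ray_open {U : Set ℂ} (hU : IsOpen U) 
    {τ : ℝ → ℂ} (hτ : Continuous τ)
    (hesc : ∀ C : Set ℂ, IsCompact C → C ⊆ U → ∃ t₀ : ℝ, ∀ t ≥ t₀, τ t ∉ C) (a : ℝ) :
    IsOpen (U \ τ '' Ici a) := by
  rw [isOpen_iff_mem_nhds]
  intro z hz
  obtain ⟨k, hk, hzk, hkU⟩ := exists_compact_subset hU hz.1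
  obtain ⟨T, hT⟩ := hesc k hk hkU
  have hcl : IsClosed (τ '' Icc a T) := (isCompact_Icc.image hτ).isClosed
  have hz' : z ∉ τ '' Icc a T := fun h => hz.2 (image_mono Icc_subset_Ici_self h)
  filter_upwards [isOpen_interior.mem_nhds hzk, hcl.isOpen_compl.mem_nhds hz'] with w hw hw'
  refine ⟨hkU (interior_subset hw), ?_⟩
  rintro ⟨s, hs, rfl⟩
  rcases le_total s T with h | h
  · exact hw' ⟨s, ⟨hs, h⟩, rfl⟩
  · exact hT s h (interior_subset hw)

theorem aux_ray {U : Set ℂ} (hU : IsOpen U) (hc : IsPreconnected U) (hlog : HasLogs U)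
    {τ : ℝ → ℂ} (hτ : Continuous τ) (hi : Function.Injective τ) (hτU : ∀ t, τ t ∈ U)
    (hesc : ∀ C : Set ℂ, IsCompact C → C ⊆ U → ∃ t₀ : ℝ, ∀ t ≥ t₀, τ t ∉ C) (a : ℝ) :
    IsPreconnected (U \ τ '' Ici a) := by
  refine aux_precon (fun x hx y hy => ?_)
  obtain ⟨S, hSc, hSp, hxS, hyS, hSU⟩ := aux_cpt hU hc hx.1 hy.1
  obtain ⟨T, hT⟩ := hesc S hSc hSU
  set b := max a T
  have hab : a ≤ b := le_max_left _ _
  have hun : τ '' Icc a b ∪ τ '' Ici b = τ '' Ici a := by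
    rw [← image_union, Icc_union_Ici_eq_Ici hab]
  have h1 : τ '' Icc a b ⊆ τ '' Ici a := hun ▸ subset_union_left
  have h2 : y ∈ connectedComponentIn (U \ τ '' Ici b) x := by
    refine hSp.subset_connectedComponentIn hxS ?_ hyS
    intro z hz
    refine ⟨hSU hz, ?_⟩
    rintro ⟨s, hs, rfl⟩
    exact hT s ((le_max_right _ _).trans hs) hz
  rw [← hun] at hx hy ⊢
  refine aux_split hU hlog (isCompact_Icc.image hτ) ?_ (aux_ray_open hU hτ hesc b) (p := τ b) ?_ hx hy
    (aux_arc hU hc hlog hτ hi hτU hab ?_ ?_) h2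
  · rintro _ ⟨s, -, rfl⟩; exact hτU s
  · rw [← image_inter hi, show Icc a b ∩ Ici b = {b} from ?_, image_singleton]
    ext t
    simp only [mem_inter_iff, mem_Icc, mem_Ici, mem_singleton_iff]
    exact ⟨fun h => le_antisymm h.1.2 h.2, fun h => ⟨⟨h ▸ hab, h.le⟩, h.ge⟩⟩
  · exact ⟨hx.1, fun h => hx.2 (Or.inl h)⟩
  · exact ⟨hy.1, fun h => hy.2 (Or.inl h)⟩

theorem aux_exp_lh : IsLocalHomeomorph Complex.exp := by
  refine IsLocalHomeomorph.mk _ (fun x => ?_)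
  have h := (Complex.hasStrictDerivAt_exp x).hasStrictFDerivAt_equiv (Complex.exp_ne_zero x)
  exact ⟨h.toOpenPartialHomeomorph Complex.exp, h.mem_toOpenPartialHomeomorph_source,
    fun _ _ => rfl⟩

open unitInterval in
theorem aux_ray_uniq {U : Set ℂ} (hsc : SimplyConnectedSpace U)
    {τ : ℝ → ℂ} (hτ : Continuous τ)
    (hesc : ∀ C : Set ℂ, IsCompact C → C ⊆ U → ∃ t₀ : ℝ, ∀ t ≥ t₀, τ t ∉ C) (a : ℝ)
    {γ γ' Γ Γ' : I → ℂ} (hγ : Continuous γ) (hγ' : Continuous γ') (hΓ : Continuous Γ)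
    (hΓ' : Continuous Γ') (hγU : ∀ s, γ s ∈ U \ τ '' Ici a) (hγU' : ∀ s, γ' s ∈ U \ τ '' Ici a)
    (h0 : γ 0 = γ' 0) (h1 : γ 1 = γ' 1) (hG0 : Γ 0 = Γ' 0)
    (he : ∀ s, Complex.exp (Γ s) = γ s - τ a) (he' : ∀ s, Complex.exp (Γ' s) = γ' s - τ a) :
    Γ 1 = Γ' 1 := by
  let pr : ℝ → I := projIcc 0 1 zero_le_one
  have hpr : Continuous pr := continuous_projIcc
  have hpr0 : pr 0 = 0 := projIcc_left _
  have hpr1 : pr 1 = 1 := projIcc_right _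
  have lift : ∀ γ : I → ℂ, Continuous γ → (∀ s, γ s ∈ U \ τ '' Ici a) →
      ∃ l : ℝ × ℝ → ℂ, Continuous l ∧ ∀ z, Complex.exp (l z) = γ (pr z.1) - τ (max a z.2) := by
    intro γ hγ hγU
    refine aux_log (fun z : ℝ × ℝ => γ (pr z.1) - τ (max a z.2)) (by fun_prop) ?_
    intro z hz
    exact (hγU (pr z.1)).2 ⟨max a z.2, mem_Ici.2 (le_max_left _ _), (sub_eq_zero.1 hz).symm⟩
  obtain ⟨l, hl, hle⟩ := lift γ hγ hγU
  obtain ⟨l', hl', hle'⟩ := lift γ' hγ' hγU'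
  let P : Path (⟨γ 0, (hγU 0).1⟩ : U) ⟨γ 1, (hγU 1).1⟩ :=
    ⟨⟨fun s => ⟨γ s, (hγU s).1⟩, by fun_prop⟩, rfl, rfl⟩
  let P' : Path (⟨γ 0, (hγU 0).1⟩ : U) ⟨γ 1, (hγU 1).1⟩ :=
    ⟨⟨fun s => ⟨γ' s, (hγU' s).1⟩, by fun_prop⟩, Subtype.ext h0.symm, Subtype.ext h1.symm⟩
  obtain ⟨F⟩ := SimplyConnectedSpace.paths_homotopic P P'
  obtain ⟨T₀, hT₀⟩ := hesc (range fun z : I × I => (F z : ℂ))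
    (isCompact_range (by fun_prop)) (by rintro _ ⟨z, rfl⟩; exact (F z).2)
  set T := max a T₀
  have hT : ∀ z, (F z : ℂ) ≠ τ T := fun z h => hT₀ T (le_max_right _ _) ⟨z, h⟩
  obtain ⟨m, hm, hme⟩ := aux_log (fun z : ℝ × ℝ => (F (pr z.1, pr z.2) : ℂ) - τ T)
    (by fun_prop) (fun z => sub_ne_zero.2 (hT _))
  have haT : max a T = T := max_eq_right (le_max_left _ _)
  have key : ∀ g g' : ℝ → ℂ, Continuous g → Continuous g' →
      (∀ s, Complex.exp (g s) = Complex.exp (g' s)) → ∀ x y, g x - g' x = g y - g' y :=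
    fun g g' hg hg' h x y => aux_exp_const isPreconnected_univ hg.continuousOn hg'.continuousOn
      (fun z _ => h z) (mem_univ _) (mem_univ _)
  have k1 := key (fun t => l (1, t)) (fun t => l' (1, t)) (by fun_prop) (by fun_prop)
    (fun t => by simp only [hle, hle', hpr1, h1]) a T
  have k2 := key (fun t => l (0, t)) (fun t => l' (0, t)) (by fun_prop) (by fun_prop)
    (fun t => by simp only [hle, hle', hpr0, h0]) a T
  have k3 := key (fun s => l (s, a)) (fun s => Γ (pr s)) (by fun_prop) (by fun_prop)
    (fun t => by simp only [hle, he, max_self]) 0 1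
  have k4 := key (fun s => l' (s, a)) (fun s => Γ' (pr s)) (by fun_prop) (by fun_prop)
    (fun t => by simp only [hle', he', max_self]) 0 1
  have k5 := key (fun s => l (s, T)) (fun s => m (0, s)) (by fun_prop) (by fun_prop)
    (fun t => by simp only [hle, hme, haT, hpr0, F.apply_zero]; rfl) 0 1
  have k6 := key (fun s => l' (s, T)) (fun s => m (1, s)) (by fun_prop) (by fun_prop)
    (fun t => by simp only [hle', hme, haT, hpr1, F.apply_one]; rfl) 0 1
  have k7 := key (fun s => m (s, 0)) (fun s => m (0, 0)) (by fun_prop) (by fun_prop)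
    (fun t => by simp only [hme, hpr0, Path.Homotopy.source]) 0 1
  have k8 := key (fun s => m (s, 1)) (fun s => m (0, 1)) (by fun_prop) (by fun_prop)
    (fun t => by simp only [hme, hpr1, Path.Homotopy.target]) 0 1
  simp only [hpr0, hpr1] at *
  linear_combination k1 - k2 - k5 + k6 + k8 - k7 + k3 - k4 + hG0

open unitInterval in
theorem aux_ray_log {U : Set ℂ} (hU : IsOpen U) (hsc : SimplyConnectedSpace U)
    {τ : ℝ → ℂ} (hτ : Continuous τ)
    (hesc : ∀ C : Set ℂ, IsCompact C → C ⊆ U → ∃ t₀ : ℝ, ∀ t ≥ t₀, τ t ∉ C) (a : ℝ)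
    (hcon : IsPreconnected (U \ τ '' Ici a)) :
    ∃ g : ℂ → ℂ, ContinuousOn g (U \ τ '' Ici a) ∧
      ∀ z ∈ U \ τ '' Ici a, Complex.exp (g z) = z - τ a := by
  classical
  rcases (U \ τ '' Ici a).eq_empty_or_nonempty with hemp | hne
  · rw [hemp]; exact ⟨fun _ => 0, continuousOn_empty _, by simp⟩
  have hBo : IsOpen (U \ τ '' Ici a) := aux_ray_open hU hτ hesc a
  set B := U \ τ '' Ici a with hB
  have : LocallyPathConnectedSpace B := hBo.locallyPathConnectedSpace
  have hpc : IsPathConnected B := hBo.isConnected_iff_isPathConnected.1 ⟨hne, hcon⟩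
  have : PathConnectedSpace B := isPathConnected_iff_pathConnectedSpace.1 hpc
  obtain ⟨z₀, hz₀⟩ := hne
  have hne' : ∀ z ∈ B, z - τ a ≠ 0 := fun z hz h => hz.2 ⟨a, self_mem_Ici, (sub_eq_zero.1 h).symm⟩
  have e0 := Complex.exp_log (hne' z₀ hz₀)
  let pr : ℝ → I := projIcc 0 1 zero_le_one
  have hpr : Continuous pr := continuous_projIcc
  have hprs : ∀ s : I, pr (s : ℝ) = s := fun s => projIcc_val _ s
  obtain ⟨F, ⟨-, hF⟩, -⟩ := aux_exp_lh.existsUnique_continuousMap_lifts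
    (⟨fun z : B => (z : ℂ) - τ a, by fun_prop⟩ : C(B, ℂ)) ⟨z₀, hz₀⟩ (Complex.log (z₀ - τ a)) e0
    (by
      intro γ hγ0
      obtain ⟨l, hl, hle⟩ := aux_log (fun s : ℝ => (γ (pr s) : ℂ) - τ a) (by fun_prop)
        (fun s => hne' _ (γ (pr s)).2)
      refine ⟨⟨fun s => l s - l 0 + Complex.log (z₀ - τ a), by fun_prop⟩, by simp, ?_⟩
      funext s
      have h00 : pr 0 = 0 := hprs 0
      have hl0 := hle 0
      rw [h00, hγ0] at hl0
      simp only [Function.comp, ContinuousMap.coe_mk, ContinuousMap.comp_apply]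
      rw [Complex.exp_add, Complex.exp_sub, hl0, hle, hprs, e0, div_mul_cancel₀ _ (hne' z₀ hz₀)])
    (by
      intro γ γ' Γ Γ' h0 h0' hG hG' hL hL' h1
      refine aux_ray_uniq hsc hτ hesc a (γ := fun s => (γ s : ℂ)) (γ' := fun s => (γ' s : ℂ))
        (by fun_prop) (by fun_prop) Γ.continuous Γ'.continuous (fun s => (γ s).2) (fun s => (γ' s).2)
        (by simp only [h0, h0']) (by simp only [h1]) (hG.trans hG'.symm)
        (fun s => congrFun hL s) (fun s => congrFun hL' s))
  refine ⟨fun z => if h : z ∈ B then F ⟨z, h⟩ else 0, ?_, ?_⟩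
  · rw [continuousOn_iff_continuous_domRestrict]
    convert! F.continuous using 1
    funext z
    simp
  · intro z hz
    simp only [hz, dif_pos]
    exact congrFun hF ⟨z, hz⟩

theorem aux_main {U : Set ℂ} (hU : IsOpen U) (hsc : SimplyConnectedSpace U)
    {σ : ℝ → ℂ} (hσ : Continuous σ) (hi : Function.Injective σ) (hσU : ∀ t, σ t ∈ U)
    (hesc : ∀ C : Set ℂ, IsCompact C → C ⊆ U → ∃ t₀ > (0 : ℝ), ∀ t : ℝ, t₀ ≤ |t| → σ t ∉ C) :
    ∃ x ∈ U \ range σ, ∃ y ∈ U \ range σ, y ∉ connectedComponentIn (U \ range σ) x ∧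
      ∀ q ∈ U \ range σ, q ∈ connectedComponentIn (U \ range σ) x ∨
        q ∈ connectedComponentIn (U \ range σ) y := by
  classical
  have hlog : HasLogs U := by
    intro f hf h0
    obtain ⟨g, hg, hge⟩ := Complex.exists_continuousOn_eqOn_exp_comp (show IsSimplyConnected U from hsc) hU hf
      (by rintro ⟨z, hz, h⟩; exact h0 z hz h)
    exact ⟨g, hg, fun z hz => hge hz⟩
  have hUc : IsPreconnected U := isPreconnected_iff_preconnectedSpace.2 inferInstance
  have hesc1 : ∀ C : Set ℂ, IsCompact C → C ⊆ U → ∃ t₀ : ℝ, ∀ t ≥ t₀, σ t ∉ C := by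
    intro C hC hCU
    obtain ⟨t₀, -, h⟩ := hesc C hC hCU
    exact ⟨t₀, fun t ht => h t (le_trans ht (le_abs_self t))⟩
  have hesc2 : ∀ C : Set ℂ, IsCompact C → C ⊆ U → ∃ t₀ : ℝ, ∀ t ≥ t₀, σ (-t) ∉ C := by
    intro C hC hCU
    obtain ⟨t₀, -, h⟩ := hesc C hC hCU
    exact ⟨t₀, fun t ht => h (-t) (by rw [abs_neg]; exact le_trans ht (le_abs_self t))⟩
  have hσ2 : Continuous (fun t => σ (-t)) := by fun_prop
  have hi2 : Function.Injective (fun t => σ (-t)) := fun s t h => neg_injective (hi h)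
  have hAo := aux_ray_open hU hσ hesc1 0
  have hBo := aux_ray_open hU hσ2 hesc2 0
  have hAc := aux_ray hU hUc hlog hσ hi hσU hesc1 0
  have hBc := aux_ray hU hUc hlog hσ2 hi2 (fun t => hσU _) hesc2 0
  obtain ⟨l, hl, hle⟩ := aux_ray_log hU hsc hσ hesc1 0 hAc
  obtain ⟨l', hl', hle'⟩ := aux_ray_log hU hsc hσ2 hesc2 0 hBc
  simp only [neg_zero] at hle'
  set A := U \ σ '' Ici 0 with hA
  set B := U \ (fun t => σ (-t)) '' Ici 0 with hB
  set p := σ 0 with hp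
  have hABi : A ∩ B = U \ range σ := by
    ext z
    constructor
    · rintro ⟨h1, h2⟩
      refine ⟨h1.1, ?_⟩
      rintro ⟨t, rfl⟩
      rcases le_total 0 t with h | h
      · exact h1.2 ⟨t, h, rfl⟩
      · exact h2.2 ⟨-t, by simpa using h, by simp⟩
    · rintro ⟨h1, h2⟩
      refine ⟨⟨h1, ?_⟩, ⟨h1, ?_⟩⟩
      · rintro ⟨t, -, rfl⟩; exact h2 ⟨t, rfl⟩
      · rintro ⟨t, -, rfl⟩; exact h2 ⟨-t, rfl⟩
  have hABu : A ∪ B = U \ {p} := by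
    ext z
    constructor
    · rintro (h | h)
      · exact ⟨h.1, fun h' => h.2 ⟨0, self_mem_Ici, h'.symm⟩⟩
      · exact ⟨h.1, fun h' => h.2 ⟨0, self_mem_Ici, by simpa using (mem_singleton_iff.1 h').symm⟩⟩
    · rintro ⟨h1, h2⟩
      by_contra hcon
      simp only [mem_union, not_or, hA, hB, Set.mem_sdiff, not_and, not_not] at hcon
      obtain ⟨s, hs, rfl⟩ := hcon.1 h1
      obtain ⟨t, ht, hst⟩ := hcon.2 h1
      have : -t = s := hi hst
      have hs' : 0 ≤ s := hs
      have ht' : 0 ≤ t := ht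
      have : s = 0 := by linarith
      subst this
      exact h2 rfl
  rw [← hABi]
  have hWo : IsOpen (A ∩ B) := hAo.inter hBo
  have hpU : p ∈ U := hσU 0
  -- lower bound
  have hnot : ¬ IsPreconnected (A ∩ B) := by
    intro hWc
    obtain ⟨c, hc, hcc⟩ : ∃ c : ℂ, Complex.exp c = 1 ∧ ∀ z ∈ A ∩ B, l z = l' z + c := by
      have hsame : ∀ z ∈ A ∩ B, Complex.exp (l z) = Complex.exp (l' z) := fun z hz => by
        rw [hle z hz.1, hle' z hz.2]
      rcases (A ∩ B).eq_empty_or_nonempty with h | ⟨z₀, hz₀⟩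
      · exact ⟨0, by simp, by simp [h]⟩
      · refine ⟨l z₀ - l' z₀, ?_, ?_⟩
        · rw [Complex.exp_sub, hsame z₀ hz₀, div_self (Complex.exp_ne_zero _)]
        · intro z hz
          have := aux_exp_const hWc (hl.mono inter_subset_left) (hl'.mono inter_subset_right)
            hsame hz hz₀
          linear_combination this
    have hG : ∀ z ∈ B, (if z ∈ A then l z else l' z + c) = l' z + c := by
      intro z hz
      split_ifs with h
      · exact hcc z ⟨h, hz⟩
      · rfl
    have : (1 : ℤ) = 0 := by
      refine aux_nolog hU (isCompact_singleton (x := p)) (singleton_subset_iff.2 hpU) rfl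
        (g := fun z => if z ∈ A then l z else l' z + c) ?_ ?_
      · rw [← hABu]
        refine ContinuousOn.union_of_isOpen ?_ ?_ hAo hBo
        · exact hl.congr (fun z hz => by simp [hz])
        · exact (hl'.add continuousOn_const).congr hG
      · rw [← hABu]
        rintro z (hz | hz)
        · simp [hz, hle z hz]
        · rw [hG z hz, Complex.exp_add, hc, hle' z hz]; simp
    exact one_ne_zero this
  obtain ⟨x, hx, y, hy, hxy⟩ : ∃ x ∈ A ∩ B, ∃ y ∈ A ∩ B, y ∉ connectedComponentIn (A ∩ B) x := by
    by_contra! hcon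
    exact hnot (aux_precon hcon)
  refine ⟨x, hx, y, hy, hxy, ?_⟩
  by_contra! hcon
  obtain ⟨q, hq, hqx, hqy⟩ := hcon
  have hyx : x ∉ connectedComponentIn (A ∩ B) y := by
    intro h
    apply hxy
    rw [← connectedComponentIn_eq h]
    exact mem_connectedComponentIn hy
  obtain ⟨n1, g1, g1', hg1, hg1', he1, he1', hV1, hV1'⟩ := aux_MV hU hlog hpU hAo hBo hABu
    (V := connectedComponentIn (A ∩ B) x) hWo.connectedComponentIn
    (connectedComponentIn_subset _ _) (aux_compl_open hWo x)
  obtain ⟨n2, g2, g2', hg2, hg2', he2, he2', hV2, hV2'⟩ := aux_MV hU hlog hpU hAo hBo hABu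
    (V := connectedComponentIn (A ∩ B) y) hWo.connectedComponentIn
    (connectedComponentIn_subset _ _) (aux_compl_open hWo y)
  have kA : ∀ z ∈ A ∩ B, ∀ w ∈ A ∩ B, n2 * g1 z - n1 * g2 z = n2 * g1 w - n1 * g2 w := by
    intro z hz w hw
    refine aux_exp_const hAc (g := fun z => n2 * g1 z) (g' := fun z => n1 * g2 z)
      (continuousOn_const.mul hg1) (continuousOn_const.mul hg2) (fun v hv => ?_) hz.1 hw.1
    rw [Complex.exp_int_mul, Complex.exp_int_mul, he1 v hv, he2 v hv, ← zpow_mul, ← zpow_mul,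
      mul_comm]
  have kB : ∀ z ∈ A ∩ B, ∀ w ∈ A ∩ B, n2 * g1' z - n1 * g2' z = n2 * g1' w - n1 * g2' w := by
    intro z hz w hw
    refine aux_exp_const hBc (g := fun z => n2 * g1' z) (g' := fun z => n1 * g2' z)
      (continuousOn_const.mul hg1') (continuousOn_const.mul hg2') (fun v hv => ?_) hz.2 hw.2
    rw [Complex.exp_int_mul, Complex.exp_int_mul, he1' v hv, he2' v hv, ← zpow_mul, ← zpow_mul,
      mul_comm]
  have hc0 : (2 * Real.pi * Complex.I : ℂ) ≠ 0 := Complex.two_pi_I_ne_zero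
  have x1 := hV1 x (mem_connectedComponentIn hx)
  have y1 := hV1' y ⟨hy, hxy⟩
  have q1 := hV1' q ⟨hq, hqx⟩
  have x2 := hV2' x ⟨hx, hyx⟩
  have y2 := hV2 y (mem_connectedComponentIn hy)
  have q2 := hV2' q ⟨hq, hqy⟩
  have e2 : (n2 : ℂ) * (2 * Real.pi * Complex.I) = 0 := by
    linear_combination kA x hx q hq - kB x hx q hq + n2 * q1 - n1 * q2 - n2 * x1 + n1 * x2
  have e1 : (n1 : ℂ) * (2 * Real.pi * Complex.I) = 0 := by
    linear_combination -(kA y hy q hq) + kB y hy q hq - n2 * q1 + n1 * q2 + n2 * y1 - n1 * y2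
  have hn1 : n1 = 0 := by exact_mod_cast (mul_eq_zero.1 e1).resolve_right hc0
  subst hn1
  have c1 : g1 x - 0 = g1 q - 0 := aux_exp_const hAc hg1 (g' := fun _ => 0) continuousOn_const
    (fun v hv => by simp [he1 v hv]) hx.1 hq.1
  have c2 : g1' x - 0 = g1' q - 0 := aux_exp_const hBc hg1' (g' := fun _ => 0) continuousOn_const
    (fun v hv => by simp [he1' v hv]) hx.2 hq.2
  exact hc0 (by linear_combination c1 - c2 + q1 - x1)

theorem aux_inv : ∃ J : OnePoint ℂ ≃ₜ OnePoint ℂ, J ∞ = ((0 : ℂ) : OnePoint ℂ) := by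
  classical
  let J : OnePoint ℂ → OnePoint ℂ := fun z => z.elim ((0 : ℂ) : OnePoint ℂ)
    (fun w => if w = 0 then ∞ else ((w⁻¹ : ℂ) : OnePoint ℂ))
  have hJi : J ∞ = ((0 : ℂ) : OnePoint ℂ) := rfl
  have hJ0 : J ((0 : ℂ) : OnePoint ℂ) = ∞ := by simp [J]
  have hJz : ∀ w : ℂ, w ≠ 0 → J (w : OnePoint ℂ) = ((w⁻¹ : ℂ) : OnePoint ℂ) := by
    intro w hw; simp [J, hw]
  have hinv : Function.Involutive J := by
    intro z
    induction z using OnePoint.rec with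
    | infty => rw [hJi, hJ0]
    | coe w =>
      by_cases hw : w = 0
      · subst hw; rw [hJ0, hJi]
      · rw [hJz w hw, hJz _ (inv_ne_zero hw), inv_inv]
  have hcob : coclosedCompact ℂ = Bornology.cobounded ℂ := by
    rw [coclosedCompact_eq_cocompact, Metric.cobounded_eq_cocompact]
  have hcont : Continuous J := by
    rw [OnePoint.continuous_iff]
    constructor
    · rw [hcob, hJi]
      refine ((OnePoint.continuous_coe.tendsto (0 : ℂ)).comp tendsto_inv₀_cobounded).congr' ?_
      filter_upwards [Bornology.isBounded_def.1 (Bornology.isBounded_singleton (x := (0 : ℂ)))] with w hw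
      exact (hJz w hw).symm
    · rw [continuous_iff_continuousAt]
      intro w
      by_cases hw : w = 0
      · subst hw
        have h1 : Tendsto (fun w : ℂ => J (w : OnePoint ℂ)) (𝓝[≠] 0) (𝓝 ∞) := by
          have : Tendsto (fun w : ℂ => ((w⁻¹ : ℂ) : OnePoint ℂ)) (𝓝[≠] 0) (𝓝 ∞) := by
            refine OnePoint.tendsto_coe_infty.comp ?_
            rw [hcob]
            exact tendsto_inv₀_nhdsNE_zero
          refine this.congr' ?_
          filter_upwards [self_mem_nhdsWithin] with w hw
          exact (hJz w hw).symm
        rw [continuousAt_iff_punctured_nhds, hJ0]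
        exact h1
      · have : ContinuousAt (fun w : ℂ => ((w⁻¹ : ℂ) : OnePoint ℂ)) w :=
          OnePoint.continuous_coe.continuousAt.comp (continuousAt_inv₀ hw)
        refine this.congr ?_
        filter_upwards [isOpen_ne.mem_nhds hw] with w hw
        exact (hJz w hw).symm
  exact ⟨Continuous.homeoOfEquivCompactToT2 (f := hinv.toPerm J) hcont, hJi⟩

theorem aux_chart {U : Set (OnePoint ℂ)} (h : (Uᶜ).Nonempty) :
    ∃ g : ℂ → OnePoint ℂ, IsOpenEmbedding g ∧ U ⊆ range g := by
  obtain ⟨q, hq⟩ := h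
  obtain ⟨H, hH⟩ : ∃ H : OnePoint ℂ ≃ₜ OnePoint ℂ, H ∞ = q := by
    induction q using OnePoint.rec with
    | infty => exact ⟨Homeomorph.refl _, rfl⟩
    | coe a =>
      obtain ⟨J, hJ⟩ := aux_inv
      refine ⟨J.trans (Homeomorph.onePointCongr (Homeomorph.addRight a)), ?_⟩
      simp [hJ, Homeomorph.onePointCongr]
  refine ⟨fun z => H z, H.isOpenEmbedding.comp OnePoint.isOpenEmbedding_coe, ?_⟩
  intro u hu
  obtain ⟨v, rfl⟩ := H.surjective u
  induction v using OnePoint.rec with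
  | infty => exact absurd hu (hH ▸ hq)
  | coe w => exact ⟨w, rfl⟩

theorem aux_cc {g : ℂ → OnePoint ℂ} (hg : IsOpenEmbedding g) {W : Set ℂ} {x y : ℂ} (hx : x ∈ W) :
    g y ∈ connectedComponentIn (g '' W) (g x) ↔ y ∈ connectedComponentIn W x := by
  constructor
  · intro h
    have hs : connectedComponentIn (g '' W) (g x) ⊆ g '' W := connectedComponentIn_subset _ _
    obtain ⟨S, hSW, hS⟩ := subset_image_iff.1 hs
    have hSp : IsPreconnected S := hg.isInducing.isPreconnected_image.1
      (hS ▸ isPreconnected_connectedComponentIn)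
    have hxS : x ∈ S := by
      have : g x ∈ g '' S := hS ▸ mem_connectedComponentIn (mem_image_of_mem g hx)
      exact (hg.injective.mem_set_image).1 this
    have hyS : y ∈ S := by
      rw [← hS] at h
      exact (hg.injective.mem_set_image).1 h
    exact hSp.subset_connectedComponentIn hxS hSW hyS
  · intro h
    have hp : IsPreconnected (g '' connectedComponentIn W x) :=
      isPreconnected_connectedComponentIn.image g hg.continuous.continuousOn
    exact hp.subset_connectedComponentIn (mem_image_of_mem g (mem_connectedComponentIn hx))
      (image_mono (connectedComponentIn_subset _ _)) (mem_image_of_mem g h)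

/-- An injective continuous curve in `U` accumulating only on `∂U` in both directions
separates `U` into exactly two connected components. -/
theorem stmt12
    (U : Set ℂ∞) (hUopen : IsOpen U) (hUconn : IsConnected U)
    (hUsc : SimplyConnectedSpace U) (hKnt : Set.Nontrivial Uᶜ)
    (σ : ℝ → ℂ∞) (hσcont : Continuous σ) (hσinj : Function.Injective σ)
    (hσU : ∀ t : ℝ, σ t ∈ U)
    (hesc : ∀ C : Set ℂ∞, IsCompact C → C ⊆ U → ∃ t₀ > (0 : ℝ), ∀ t : ℝ, t₀ ≤ |t| → σ t ∉ C) :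
    ∃ x ∈ U \ Set.range σ, ∃ y ∈ U \ Set.range σ,
      connectedComponentIn (U \ Set.range σ) x ≠ connectedComponentIn (U \ Set.range σ) y ∧
      ∀ p ∈ U \ Set.range σ,
        connectedComponentIn (U \ Set.range σ) p = connectedComponentIn (U \ Set.range σ) x ∨
        connectedComponentIn (U \ Set.range σ) p = connectedComponentIn (U \ Set.range σ) y := by
  obtain ⟨g, hg, hUg⟩ := aux_chart hKnt.nonempty
  have hUim : g '' (g ⁻¹' U) = U := image_preimage_eq_of_subset hUg
  have hs : ∀ t, ∃ z, g z = σ t := fun t => hUg (hσU t)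
  choose τ hτ using hs
  have hτe : g ∘ τ = σ := funext hτ
  have hτc : Continuous τ := hg.isInducing.continuous_iff.2 (hτe ▸ hσcont)
  have hτi : Function.Injective τ := fun s t h => hσinj (by rw [← hτ, ← hτ, h])
  have hsc : SimplyConnectedSpace (g ⁻¹' U) := by
    have : IsSimplyConnected (g ⁻¹' U) := by
      rw [← hg.isEmbedding.isSimplyConnected_image, hUim]; exact hUsc
    exact this
  have hW : U \ Set.range σ = g '' (g ⁻¹' U \ Set.range τ) := by
    rw [image_sdiff hg.injective, hUim, ← range_comp, hτe]
  obtain ⟨x, hx, y, hy, hxy, hall⟩ := aux_main (hUopen.preimage hg.continuous) hsc hτc hτi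
    (fun t => by rw [mem_preimage, hτ]; exact hσU t) (by
      intro C hC hCU
      obtain ⟨t₀, h0, h⟩ := hesc (g '' C) (hC.image hg.continuous) (image_subset_iff.2 hCU)
      exact ⟨t₀, h0, fun t ht hm => h t ht ⟨_, hm, hτ t⟩⟩)
  rw [hW]
  refine ⟨g x, mem_image_of_mem g hx, g y, mem_image_of_mem g hy, ?_, ?_⟩
  · intro h
    apply hxy
    rw [← aux_cc hg hx, h]
    exact mem_connectedComponentIn (mem_image_of_mem g hy)
  · rintro _ ⟨q, hq, rfl⟩
    rcases hall q hq with h | h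
    · exact Or.inl (connectedComponentIn_eq ((aux_cc hg hx).2 h)).symm
    · exact Or.inr (connectedComponentIn_eq ((aux_cc hg hy).2 h)).symm

end
end
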